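/- Let A be a von Neumann algebra in standard form acting on L²(A). Then the commutant of the left action of A on L²(A) equals the right action of A (equivalently, is anti-isomorphic to A), and consequently every bounded operator on L²(A) commuting with the left A-action is given by right multiplication by a unique element of A. -/

import Mathlib

namespace TomitaTakesaki

open scoped InnerProductSpace ComplexConjugate
open Complex (I)

section RealSubspace

variable {H : Type*} [NormedAddCommGroup H] [InnerProductSpace ℂ H]

/-- A real-linear operator commuting with multiplication by `I` is complex-linear. -/
noncomputable def linearOfReal (f : H →L[ℝ] H) (h : ∀ x, f (I • x) = I • f x) : H →L[ℂ] H where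
  toFun := f
  map_add' := map_add f
  map_smul' c x := by
    conv_lhs => rw [← Complex.re_add_im c]
    simp only [add_smul, mul_smul, map_add, Complex.coe_smul, map_smul, h, RingHom.id_apply]
    conv_rhs => rw [← Complex.re_add_im c]
    simp only [add_smul, mul_smul, Complex.coe_smul]
  cont := f.continuous

/-- A real-linear operator anticommuting with multiplication by `I` is conjugate-linear. -/
noncomputable def conjLinearOfReal (f : H →L[ℝ] H) (h : ∀ x, f (I • x) = -(I • f x)) : H →L⋆[ℂ] H where
  toFun := f
  map_add' := map_add f
  map_smul' c x := by
    conv_lhs => rw [← Complex.re_add_im c]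
    simp only [add_smul, mul_smul, map_add, Complex.coe_smul, map_smul, h]
    conv_rhs => rw [← Complex.re_add_im c]
    simp only [map_add, map_mul, Complex.conj_ofReal, Complex.conj_I, add_smul, mul_smul,
      Complex.coe_smul, neg_smul, smul_neg]
  cont := f.continuous

/-- Multiplication by `I` as a real-linear operator. -/
noncomputable def mulI : H →L[ℝ] H := (I • (1 : H →L[ℂ] H)).restrictScalars ℝ

attribute [local instance] InnerProductSpace.complexToReal

lemma inner_real_eq_re (x y : H) : inner ℝ x y = (inner ℂ x y).re := rfl

variable (K : Submodule ℝ H) [K.HasOrthogonalProjection]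

/-- The projection onto `I • K`. -/
noncomputable def rotProj : H →L[ℝ] H := mulI ∘L K.starProjection ∘L (-mulI)

lemma rotProj_apply (x : H) : rotProj K x = I • K.starProjection (-(I • x)) := rfl

lemma I_smul_I_smul (x : H) : I • I • x = -x := by
  rw [smul_smul, Complex.I_mul_I, neg_one_smul]

/-- The sum of the projections onto `K` and `I • K`. -/
noncomputable def projSum : H →L[ℂ] H :=
  linearOfReal (K.starProjection + rotProj K) fun x => by
    simp only [add_apply, rotProj_apply, I_smul_I_smul, neg_neg, smul_add, map_neg, smul_neg]
    abel

/-- The difference of the projections onto `K` and `I • K`. -/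
noncomputable def projDiff : H →L⋆[ℂ] H :=
  conjLinearOfReal (K.starProjection - rotProj K) fun x => by
    simp only [sub_apply, rotProj_apply, I_smul_I_smul, neg_neg, smul_sub, map_neg, smul_neg]
    abel

lemma projSum_apply (x : H) : projSum K x = K.starProjection x + rotProj K x := rfl

lemma projDiff_apply (x : H) : projDiff K x = K.starProjection x - rotProj K x := rfl

lemma starProjection_idem (x : H) :
    K.starProjection (K.starProjection x) = K.starProjection x :=
  K.starProjection_eq_self_iff.2 (K.starProjection_apply_mem x)

lemma rotProj_idem (x : H) : rotProj K (rotProj K x) = rotProj K x := by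
  simp only [rotProj_apply, I_smul_I_smul, neg_neg, starProjection_idem]

lemma starProjection_I_smul (x : H) : K.starProjection (I • x) = I • rotProj K x := by
  simp only [rotProj_apply, I_smul_I_smul, map_neg, neg_neg]

lemma re_inner_starProjection (x y : H) :
    (inner ℂ (K.starProjection x) y).re = (inner ℂ x (K.starProjection y)).re :=
  K.inner_starProjection_left_eq_right x y

lemma re_inner_comm (x y : H) : (inner ℂ x y).re = (inner ℂ y x).re :=
  inner_re_symm (𝕜 := ℂ) x y

lemma re_inner_I_smul (x y : H) : (inner ℂ (I • x) y).re = -(inner ℂ x (I • y)).re := by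
  simp

lemma re_inner_rotProj (x y : H) :
    (inner ℂ (rotProj K x) y).re = (inner ℂ x (rotProj K y)).re := by
  simp only [rotProj_apply, re_inner_I_smul, map_neg, smul_neg, inner_neg_left, inner_neg_right,
    Complex.neg_re, neg_neg, re_inner_starProjection]

lemma inner_eq_of_re {f g : H → H → ℂ} (h : ∀ x y, (f x y).re = (g x y).re)
    (hf : ∀ x y, f x (I • y) = I * f x y) (hg : ∀ x y, g x (I • y) = I * g x y) (x y : H) :
    f x y = g x y := by
  refine Complex.ext (h x y) ?_
  have := h x (I • y)
  rw [hf, hg] at this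
  simpa using this

lemma inner_projSum (x y : H) : inner ℂ (projSum K x) y = inner ℂ x (projSum K y) := by
  refine inner_eq_of_re (f := fun x y => inner ℂ (projSum K x) y)
    (g := fun x y => inner ℂ x (projSum K y)) (fun x y => ?_) (fun x y => ?_) (fun x y => ?_) x y
  · simp only [projSum_apply, inner_add_left, inner_add_right, Complex.add_re,
      re_inner_starProjection, re_inner_rotProj]
  · simp
  · simp

lemma inner_projDiff (x y : H) : inner ℂ (projDiff K x) y = inner ℂ (projDiff K y) x := by
  refine inner_eq_of_re (f := fun x y => inner ℂ (projDiff K x) y)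
    (g := fun x y => inner ℂ (projDiff K y) x) (fun x y => ?_) (fun x y => ?_) (fun x y => ?_) x y
  · rw [re_inner_comm (projDiff K y) x]
    simp only [projDiff_apply, inner_sub_left, inner_sub_right, Complex.sub_re,
      re_inner_starProjection, re_inner_rotProj]
  · simp
  · simp [inner_smul_left]

lemma re_inner_projSum_self (x : H) :
    (inner ℂ (projSum K x) x).re = ‖K.starProjection x‖ ^ 2 + ‖rotProj K x‖ ^ 2 := by
  rw [projSum_apply, inner_add_left, Complex.add_re]
  conv_lhs => rw [← starProjection_idem, ← rotProj_idem, re_inner_starProjection, re_inner_rotProj]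
  rw [inner_self_eq_norm_sq_to_K, inner_self_eq_norm_sq_to_K]
  norm_cast

lemma re_inner_two_sub_projSum_self (x : H) :
    (inner ℂ ((2 : ℂ) • x - projSum K x) x).re =
      ‖x - K.starProjection x‖ ^ 2 + ‖x - rotProj K x‖ ^ 2 := by
  have h := re_inner_projSum_self K x
  rw [← @inner_self_eq_norm_sq ℂ, ← @inner_self_eq_norm_sq ℂ] at h ⊢
  simp only [inner_sub_left, inner_sub_right, map_sub, inner_smul_left, RCLike.re_to_complex] at h ⊢
  have h1 := re_inner_starProjection K x x
  have h2 := re_inner_rotProj K x x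
  simp only [projSum_apply, inner_add_left, Complex.sub_re, Complex.add_re] at h ⊢
  rw [map_ofNat, two_mul, Complex.add_re]
  linarith

lemma projDiff_projDiff (x : H) :
    projDiff K (projDiff K x) = projSum K ((2 : ℂ) • x - projSum K x) := by
  simp only [projDiff_apply, projSum_apply, map_sub, map_add, starProjection_idem, rotProj_idem,
    two_smul]
  abel

lemma two_sub_projSum_projDiff (x : H) :
    (2 : ℂ) • projDiff K x - projSum K (projDiff K x) = projDiff K (projSum K x) := by
  simp only [projDiff_apply, projSum_apply, map_sub, map_add, starProjection_idem, rotProj_idem,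
    two_smul]
  abel

lemma starProjection_eq_zero_of_projSum_eq_zero {x : H} (hx : projSum K x = 0) :
    K.starProjection x = 0 ∧ rotProj K x = 0 := by
  have h := re_inner_projSum_self K x
  rw [hx, inner_zero_left, Complex.zero_re] at h
  constructor <;> rw [← norm_eq_zero] <;> nlinarith [sq_nonneg ‖K.starProjection x‖, sq_nonneg ‖rotProj K x‖]

lemma mem_of_projSum_eq_two_smul {x : H} (hx : (2 : ℂ) • x - projSum K x = 0) :
    x ∈ K ∧ I • x ∈ K := by
  have h := re_inner_two_sub_projSum_self K x
  rw [hx, inner_zero_left, Complex.zero_re] at h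
  have h1 : x - K.starProjection x = 0 := by
    rw [← norm_eq_zero]
    nlinarith [sq_nonneg ‖x - K.starProjection x‖, sq_nonneg ‖x - rotProj K x‖]
  have h2 : x - rotProj K x = 0 := by
    rw [← norm_eq_zero]
    nlinarith [sq_nonneg ‖x - K.starProjection x‖, sq_nonneg ‖x - rotProj K x‖]
  rw [sub_eq_zero] at h1 h2
  refine ⟨K.starProjection_eq_self_iff.1 h1.symm, K.starProjection_eq_self_iff.1 ?_⟩
  rw [starProjection_I_smul, ← h2]

end RealSubspace

section Polar

variable {H : Type*} [NormedAddCommGroup H] [InnerProductSpace ℂ H] [CompleteSpace H]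

lemma dense_of_forall_inner_eq_zero (V : Submodule ℂ H)
    (h : ∀ x, (∀ v ∈ V, inner ℂ v x = 0) → x = 0) : Dense (V : Set H) := by
  rw [Submodule.dense_iff_topologicalClosure_eq_top, Submodule.topologicalClosure_eq_top_iff,
    Submodule.eq_bot_iff]
  exact fun x hx => h x fun v hv => (Submodule.mem_orthogonal V x).1 hx v hv

lemma denseRange_of_symmetric_injective {T : H →L[ℂ] H}
    (hT : ∀ x y, inner ℂ (T x) y = inner ℂ x (T y)) (hinj : ∀ x, T x = 0 → x = 0) :
    DenseRange T := by
  have := dense_of_forall_inner_eq_zero T.range fun x hx => hinj x <| by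
    rw [← inner_self_eq_zero (𝕜 := ℂ), ← hT]
    exact hx _ ⟨_, rfl⟩
  exact this

lemma denseRange_of_conj_symmetric_injective {N : H →L⋆[ℂ] H}
    (hN : ∀ x y, inner ℂ (N x) y = inner ℂ (N y) x) (hinj : ∀ x, N x = 0 → x = 0) :
    DenseRange N := by
  have := dense_of_forall_inner_eq_zero N.range fun x hx => hinj x <| by
    rw [← inner_self_eq_zero (𝕜 := ℂ), hN]
    exact hx _ ⟨_, rfl⟩
  exact this

lemma nonneg_of_inner {T : H →L[ℂ] H} (hT : ∀ x y, inner ℂ (T x) y = inner ℂ x (T y))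
    (hpos : ∀ x, 0 ≤ (inner ℂ (T x) x).re) : 0 ≤ T := by
  rw [ContinuousLinearMap.nonneg_iff_isPositive]
  exact ⟨fun x y => hT x y, fun x => hpos x⟩

lemma inner_comm_of_nonneg {T : H →L[ℂ] H} (hT : 0 ≤ T) (x y : H) :
    inner ℂ (T x) y = inner ℂ x (T y) :=
  ((ContinuousLinearMap.nonneg_iff_isPositive T).1 hT).isSymmetric x y

/-- The polar decomposition of an injective conjugate-linear symmetric operator. -/
theorem exists_conj_polar (N : H →L⋆[ℂ] H) (hN : ∀ x y, inner ℂ (N x) y = inner ℂ (N y) x)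
    (hinj : ∀ x, N x = 0 → x = 0) {T : H →L[ℂ] H} (hT0 : 0 ≤ T) (hTT : ∀ x, T (T x) = N (N x)) :
    ∃ J : H →L⋆[ℂ] H, (∀ x, J (T x) = N x) ∧ (∀ x, T (J x) = N x) ∧
      (∀ x, J (J x) = x) ∧ ∀ x y, inner ℂ (J x) y = inner ℂ (J y) x := by
  have hT := inner_comm_of_nonneg hT0
  have hTinj : ∀ x, T x = 0 → x = 0 := fun x hx => by
    have := hTT x
    rw [hx, map_zero] at this
    exact hinj _ (hinj _ this.symm)
  have hTd := denseRange_of_symmetric_injective hT hTinj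
  have hNd := denseRange_of_conj_symmetric_injective hN hinj
  have hNT : ∀ x y, inner ℂ (N x) (N y) = inner ℂ (T y) (T x) := fun x y => by
    rw [hN, ← hTT, hT]
  have hnorm : ∀ x, ‖N x‖ = ‖T x‖ := fun x => by
    rw [← sq_eq_sq₀ (norm_nonneg _) (norm_nonneg _), ← @inner_self_eq_norm_sq ℂ,
      ← @inner_self_eq_norm_sq ℂ, hNT]
  let J : H →L⋆[ℂ] H := N.toLinearMap.extendOfNorm T.toLinearMap
  have hJT : ∀ x, J (T x) = N x :=
    LinearMap.extendOfNorm_eq hTd ⟨1, fun x => by simpa using (hnorm x).le⟩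
  have hJJ : ∀ x y, inner ℂ (J x) (J y) = inner ℂ y x := by
    intro x y
    induction x using hTd.induction_on with
    | hp => exact isClosed_eq (by fun_prop) (by fun_prop)
    | ih x =>
      induction y using hTd.induction_on with
      | hp => exact isClosed_eq (by fun_prop) (by fun_prop)
      | ih y => rw [hJT, hJT, hNT]
  have hJn : ∀ x, ‖J x‖ = ‖x‖ := fun x => by
    rw [← sq_eq_sq₀ (norm_nonneg _) (norm_nonneg _), ← @inner_self_eq_norm_sq ℂ,
      ← @inner_self_eq_norm_sq ℂ, hJJ]
  have hJs : Function.Surjective J := by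
    have h1 : IsClosed (Set.range J) :=
      (AddMonoidHomClass.isometry_of_norm J hJn).isClosedEmbedding.isClosed_range
    have h2 : Dense (Set.range J) := hNd.mono <| by
      rintro _ ⟨x, rfl⟩
      exact ⟨T x, hJT x⟩
    rw [← Set.range_eq_univ, ← h1.closure_eq, h2.closure_eq]
  have hJTJ : ∀ x, J (T (J x)) = T x := fun z => by
    refine ext_inner_right ℂ fun x => ?_
    rw [hJT, hN, ← hJT, hJJ, hT]
  let e : H ≃ₗᵢ⋆[ℂ] H := LinearIsometryEquiv.ofSurjective ⟨J.toLinearMap, hJn⟩ hJs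
  have he : ∀ x, e x = J x := fun _ => rfl
  let A : H →L[ℂ] H := J ∘SL T ∘SL (e.symm.toContinuousLinearEquiv : H →L⋆[ℂ] H)
  have hA : ∀ x, A (J x) = N x := fun x => by
    show J (T (e.symm (J x))) = _
    rw [← he x, e.symm_apply_apply, hJT]
  have hA0 : 0 ≤ A := by
    refine nonneg_of_inner (fun x y => ?_) fun x => ?_
    · obtain ⟨x, rfl⟩ := hJs x
      obtain ⟨y, rfl⟩ := hJs y
      rw [hA, hA, ← hJT, ← hJT, hJJ, hJJ, hT]
    · obtain ⟨x, rfl⟩ := hJs x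
      rw [hA, ← hJT, hJJ, ← hT]
      exact ((ContinuousLinearMap.nonneg_iff_isPositive T).1 hT0).re_inner_nonneg_left x
  have hAA : A * A = T * T := by
    ext x
    obtain ⟨x, rfl⟩ := hJs x
    simp only [mul_apply_eq_comp]
    rw [hA, ← hJT, hA, ← hJT, ← hJTJ (T (J x)), hJTJ x]
  have hAT : A = T := by
    rw [← CFC.sqrt_unique (rfl : T * T = T * T) hT0, CFC.sqrt_unique hAA hA0]
  have hTJ : ∀ x, T (J x) = N x := fun x => by rw [← hAT, hA]
  have hJ2 : ∀ x, J (J x) = x := by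
    intro x
    induction x using hTd.induction_on with
    | hp => exact isClosed_eq (by fun_prop) (by fun_prop)
    | ih x => rw [hJT, ← hTJ, hJTJ]
  refine ⟨J, hJT, hTJ, hJ2, fun x y => ?_⟩
  conv_lhs => rw [← hJ2 y]
  rw [hJJ]

end Polar

section Kernel

open MeasureTheory Filter Topology

/-- The kernel `1 / cosh (π t)`. -/
noncomputable def sech (t : ℝ) : ℝ := (Real.cosh (Real.pi * t))⁻¹

lemma sech_pos (t : ℝ) : 0 < sech t := inv_pos.2 (Real.cosh_pos _)

lemma continuous_sech : Continuous sech :=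
  Continuous.inv₀ (by fun_prop) fun t => (Real.cosh_pos _).ne'

lemma sech_le (t : ℝ) : sech t ≤ 2 * Real.exp (-(Real.pi * |t|)) := by
  rw [sech, ← Real.cosh_abs, abs_mul, abs_of_pos Real.pi_pos, Real.exp_neg, Real.cosh_eq,
    ← div_eq_mul_inv, inv_div]
  have := Real.exp_pos (-(Real.pi * |t|))
  gcongr
  linarith

lemma integrable_exp_neg_mul_abs {c : ℝ} (hc : 0 < c) :
    Integrable fun t : ℝ => Real.exp (-(c * |t|)) := by
  rw [← integrableOn_univ, ← Set.Iic_union_Ioi (a := (0 : ℝ)), integrableOn_union]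
  constructor
  · refine (integrableOn_exp_mul_Iic hc 0).congr_fun (fun t ht => ?_) measurableSet_Iic
    rw [abs_of_nonpos (Set.mem_Iic.1 ht), mul_neg, neg_neg]
  · refine (integrableOn_exp_mul_Ioi (neg_neg_of_pos hc) 0).congr_fun (fun t ht => ?_)
      measurableSet_Ioi
    rw [abs_of_pos (Set.mem_Ioi.1 ht), ← neg_mul]

lemma integrable_exp_mul_sech {θ : ℝ} (hθ : |θ| < Real.pi) :
    Integrable fun t : ℝ => Real.exp (θ * t) * sech t := by
  refine ((integrable_exp_neg_mul_abs (sub_pos.2 hθ)).const_mul 2).mono'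
    (by have := continuous_sech; fun_prop) (Eventually.of_forall fun t => ?_)
  rw [Real.norm_eq_abs, abs_of_pos (mul_pos (Real.exp_pos _) (sech_pos _))]
  calc _ ≤ Real.exp (|θ| * |t|) * (2 * Real.exp (-(Real.pi * |t|))) := by
        refine mul_le_mul (Real.exp_le_exp.2 ((le_abs_self _).trans (abs_mul _ _).le))
          (sech_le t) (sech_pos t).le (Real.exp_pos _).le
    _ = _ := by
        rw [mul_left_comm, ← Real.exp_add]
        ring_nf

lemma integrable_bdd_mul_exp_mul_sech {θ : ℝ} (hθ : |θ| < Real.pi) {E : Type*}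
    [NormedAddCommGroup E] [NormedSpace ℝ E] {h : ℝ → E} (hc : Continuous h)
    {C : ℝ} (hb : ∀ t, ‖h t‖ ≤ C) :
    Integrable fun t : ℝ => (Real.exp (θ * t) * sech t) • h t := by
  refine ((integrable_exp_mul_sech hθ).mul_const C).mono'
    (by have := continuous_sech; fun_prop) (Eventually.of_forall fun t => ?_)
  have := mul_pos (Real.exp_pos (θ * t)) (sech_pos t)
  rw [norm_smul, Real.norm_eq_abs, abs_of_pos this]
  gcongr
  exact hb t

/-- The measure with density `sech · h`. -/
noncomputable def sechMeasure (h : ℝ → ℝ) : Measure ℝ :=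
  volume.withDensity fun t => ENNReal.ofReal (sech t * h t)

lemma integrable_sechMeasure_iff {h : ℝ → ℝ} (hc : Continuous h) (h0 : ∀ t, 0 ≤ h t)
    {E : Type*} [NormedAddCommGroup E] [NormedSpace ℝ E] (g : ℝ → E) :
    Integrable g (sechMeasure h) ↔ Integrable fun t => (sech t * h t) • g t := by
  have := continuous_sech
  rw [sechMeasure, integrable_withDensity_iff_integrable_smul' (by fun_prop) (by simp)]
  simp only [ENNReal.toReal_ofReal (mul_nonneg (sech_pos _).le (h0 _))]

lemma integral_sechMeasure {h : ℝ → ℝ} (hc : Continuous h) (h0 : ∀ t, 0 ≤ h t)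
    {E : Type*} [NormedAddCommGroup E] [NormedSpace ℝ E] (g : ℝ → E) :
    ∫ t, g t ∂(sechMeasure h) = ∫ t, (sech t * h t) • g t := by
  have := continuous_sech
  rw [sechMeasure, integral_withDensity_eq_integral_toReal_smul (by fun_prop) (by simp)]
  simp only [ENNReal.toReal_ofReal (mul_nonneg (sech_pos _).le (h0 _))]

lemma mem_interior_integrableExpSet {h : ℝ → ℝ} (hc : Continuous h) (h0 : ∀ t, 0 ≤ h t)
    {C : ℝ} (hb : ∀ t, h t ≤ C) {θ : ℝ} (hθ : |θ| < Real.pi) :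
    θ ∈ interior (ProbabilityTheory.integrableExpSet id (sechMeasure h)) := by
  refine interior_maximal (s := ProbabilityTheory.integrableExpSet id (sechMeasure h))
    (t := {θ | |θ| < Real.pi}) (fun s hs => ?_) (isOpen_lt (by fun_prop) (by fun_prop)) hθ
  show Integrable _ _
  rw [integrable_sechMeasure_iff hc h0]
  refine (integrable_bdd_mul_exp_mul_sech hs hc (C := C) fun t => ?_).congr
    (Eventually.of_forall fun t => ?_)
  · rw [Real.norm_eq_abs, abs_of_nonneg (h0 t)]
    exact hb t
  · simp only [smul_eq_mul, id]
    ring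

/-- Uniqueness for the transform `θ ↦ ∫ exp (θ t) h t / cosh (π t)`, real version. -/
lemma eq_zero_of_integral_exp_mul_sech_real {h : ℝ → ℝ} (hc : Continuous h)
    {C : ℝ} (hb : ∀ t, ‖h t‖ ≤ C)
    (hh : ∀ θ : ℝ, |θ| < Real.pi → ∫ t, (Real.exp (θ * t) * sech t) • h t = 0) (t : ℝ) :
    h t = 0 := by
  have hC : 0 ≤ C := (norm_nonneg _).trans (hb 0)
  set h₁ : ℝ → ℝ := fun t => h t + C with h1def
  set h₂ : ℝ → ℝ := fun _ => C with h2def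
  have hc1 : Continuous h₁ := by fun_prop
  have hc2 : Continuous h₂ := by fun_prop
  have h10 : ∀ t, 0 ≤ h₁ t := fun t => by
    have := (abs_le.1 (hb t)).1
    simp only [h1def]; linarith
  have h20 : ∀ t, 0 ≤ h₂ t := fun t => hC
  have h1b : ∀ t, h₁ t ≤ 2 * C := fun t => by
    have := (abs_le.1 (hb t)).2
    simp only [h1def]; linarith
  have h2b : ∀ t, h₂ t ≤ C := fun t => le_rfl
  have m1 := fun θ (hθ : |θ| < Real.pi) => mem_interior_integrableExpSet hc1 h10 h1b hθ
  have m2 := fun θ (hθ : |θ| < Real.pi) => mem_interior_integrableExpSet hc2 h20 h2b hθ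
  have hfin : ∀ {g : ℝ → ℝ} (_ : ∀ θ : ℝ, |θ| < Real.pi →
      θ ∈ interior (ProbabilityTheory.integrableExpSet id (sechMeasure g))),
      IsFiniteMeasure (sechMeasure g) := fun hg => by
    have := interior_subset (hg 0 (by simpa using Real.pi_pos))
    have := ProbabilityTheory.integrable_of_mem_integrableExpSet this
    simpa [integrable_const_iff] using this
  have := hfin m1
  have := hfin m2
  let U : Set ℂ := {z | |z.re| < Real.pi}
  have hUo : IsOpen U := isOpen_lt (by fun_prop) (by fun_prop)
  have hUc : IsPreconnected U := by
    have : Convex ℝ U := by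
      have : U = Complex.reLm ⁻¹' Metric.ball 0 Real.pi := by ext; simp [U]
      rw [this]
      exact (convex_ball _ _).linear_preimage _
    exact this.isPreconnected
  have hA : ∀ {g : ℝ → ℝ} (_ : ∀ θ : ℝ, |θ| < Real.pi →
      θ ∈ interior (ProbabilityTheory.integrableExpSet id (sechMeasure g))),
      AnalyticOnNhd ℂ (ProbabilityTheory.complexMGF id (sechMeasure g)) U :=
    fun hg z hz => ProbabilityTheory.analyticAt_complexMGF (hg _ hz)
  have hreal : ∀ θ : ℝ, |θ| < Real.pi → ProbabilityTheory.complexMGF id (sechMeasure h₁) θ =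
      ProbabilityTheory.complexMGF id (sechMeasure h₂) θ := fun θ hθ => by
    rw [ProbabilityTheory.complexMGF_ofReal, ProbabilityTheory.complexMGF_ofReal]
    congr 1
    rw [ProbabilityTheory.mgf, ProbabilityTheory.mgf, integral_sechMeasure hc1 h10,
      integral_sechMeasure hc2 h20]
    have e := integral_add (integrable_bdd_mul_exp_mul_sech hθ hc hb)
      (integrable_bdd_mul_exp_mul_sech hθ hc2 (C := C) fun t => by
        rw [Real.norm_eq_abs, abs_of_nonneg hC])
    rw [hh θ hθ, zero_add] at e
    refine Eq.trans ?_ (e.trans ?_)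
    all_goals
      congr 1
      ext t
      simp only [smul_eq_mul, id, h1def, h2def]
      ring
  have key : Set.EqOn (ProbabilityTheory.complexMGF id (sechMeasure h₁))
      (ProbabilityTheory.complexMGF id (sechMeasure h₂)) U := by
    refine (hA m1).eqOn_of_preconnected_of_frequently_eq (hA m2) hUc (z₀ := 0)
      (by simpa [U] using Real.pi_pos) ?_
    have ht : Tendsto (fun n : ℕ => (((1 : ℝ) / (n + 1) : ℝ) : ℂ)) atTop (𝓝[≠] 0) := by
      refine tendsto_nhdsWithin_of_tendsto_nhds_of_eventually_within _ ?_
        (Eventually.of_forall fun n => ?_)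
      · exact (Complex.continuous_ofReal.tendsto' 0 0 rfl).comp
          tendsto_one_div_add_atTop_nhds_zero_nat
      · simp only [Set.mem_compl_iff, Set.mem_singleton_iff, Complex.ofReal_eq_zero]
        positivity
    refine ht.frequently (Eventually.of_forall fun n => hreal _ ?_).frequently
    rw [abs_of_pos (by positivity)]
    have : (1 : ℝ) / (n + 1) ≤ 1 := by
      rw [div_le_one (by positivity)]
      linarith [(Nat.cast_nonneg n : (0 : ℝ) ≤ n)]
    linarith [Real.pi_gt_three]
  have hμ : sechMeasure h₁ = sechMeasure h₂ := by
    refine Measure.ext_of_charFun (funext fun t => ?_)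
    rw [← ProbabilityTheory.complexMGF_id_mul_I, ← ProbabilityTheory.complexMGF_id_mul_I]
    exact key (by simpa [U] using Real.pi_pos)
  have hs := continuous_sech
  rw [sechMeasure, sechMeasure, withDensity_eq_iff_of_sigmaFinite (by fun_prop) (by fun_prop)] at hμ
  have hfun := Measure.eq_of_ae_eq (μ := volume) hμ
    (ENNReal.continuous_ofReal.comp (by fun_prop)) (ENNReal.continuous_ofReal.comp (by fun_prop))
  have := congrFun hfun t
  rw [ENNReal.ofReal_eq_ofReal_iff (mul_nonneg (sech_pos t).le (h10 t))
    (mul_nonneg (sech_pos t).le (h20 t))] at this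
  have := mul_left_cancel₀ (sech_pos t).ne' this
  simpa [h1def, h2def] using this

/-- Uniqueness for the transform `θ ↦ ∫ exp (θ t) h t / cosh (π t)`. -/
lemma eq_zero_of_integral_exp_mul_sech {h : ℝ → ℂ} (hc : Continuous h)
    {C : ℝ} (hb : ∀ t, ‖h t‖ ≤ C)
    (hh : ∀ θ : ℝ, |θ| < Real.pi → ∫ t, (Real.exp (θ * t) * sech t) • h t = 0) (t : ℝ) :
    h t = 0 := by
  have hint := fun θ hθ => integrable_bdd_mul_exp_mul_sech (θ := θ) hθ hc hb
  refine Complex.ext ?_ ?_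
  · refine eq_zero_of_integral_exp_mul_sech_real (h := fun t => (h t).re) (by fun_prop)
      (fun t => (Complex.abs_re_le_norm _).trans (hb t)) (fun θ hθ => ?_) t
    have := integral_re (𝕜 := ℂ) (hint θ hθ)
    rw [hh θ hθ] at this
    simpa only [RCLike.re_to_complex, Complex.smul_re, map_zero, smul_eq_mul] using this
  · refine eq_zero_of_integral_exp_mul_sech_real (h := fun t => (h t).im) (by fun_prop)
      (fun t => (Complex.abs_im_le_norm _).trans (hb t)) (fun θ hθ => ?_) t
    have := integral_im (𝕜 := ℂ) (hint θ hθ)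
    rw [hh θ hθ] at this
    simpa only [RCLike.im_to_complex, Complex.smul_im, map_zero, smul_eq_mul] using this

end Kernel

section Contour

open MeasureTheory Filter Topology

lemma half_exp_sub_le_norm_sin (z : ℂ) :
    (Real.exp |z.im| - 1) / 2 ≤ ‖Complex.sin z‖ := by
  have h1 : ‖Complex.exp (-z * I)‖ = Real.exp z.im := by simp [Complex.norm_exp]
  have h2 : ‖Complex.exp (z * I)‖ = Real.exp (-z.im) := by simp [Complex.norm_exp]
  have h : ‖Complex.sin z‖ = ‖Complex.exp (-z * I) - Complex.exp (z * I)‖ / 2 := by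
    rw [Complex.sin]; simp
  rw [h]
  gcongr
  have h3 := norm_sub_norm_le (Complex.exp (-z * I)) (Complex.exp (z * I))
  have h4 := norm_sub_norm_le (Complex.exp (z * I)) (Complex.exp (-z * I))
  rw [norm_sub_rev] at h4
  rw [h1, h2] at h3 h4
  rcases abs_cases z.im with ⟨e, h0⟩ | ⟨e, h0⟩
  · rw [e]
    have : Real.exp (-z.im) ≤ 1 := Real.exp_le_one_iff.2 (by linarith)
    linarith
  · rw [e]
    have : Real.exp (z.im) ≤ 1 := Real.exp_le_one_iff.2 (by linarith)
    linarith

lemma sin_pi_mul_ne_zero {w : ℂ} (hw : |w.re| ≤ 1 / 2) (h0 : w ≠ 0) :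
    Complex.sin (Real.pi * w) ≠ 0 := by
  intro h
  obtain ⟨k, hk⟩ := Complex.sin_eq_zero_iff.1 h
  rw [mul_comm] at hk
  have hk := mul_right_cancel₀ (Complex.ofReal_ne_zero.2 Real.pi_ne_zero) hk
  subst hk
  rw [Complex.intCast_re] at hw
  have hw' : |k| < 1 := by
    have : ((|k| : ℤ) : ℝ) < 1 := by push_cast; linarith
    exact_mod_cast this
  exact h0 (by rw [Int.abs_lt_one_iff.1 hw', Int.cast_zero])

lemma sin_pi_mul_half_add (t : ℝ) :
    Complex.sin (Real.pi * ((1 / 2 : ℝ) + t * I)) = (Real.cosh (Real.pi * t) : ℂ) := by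
  rw [show (Real.pi * ((1 / 2 : ℝ) + t * I) : ℂ) = (Real.pi * t : ℝ) * I + Real.pi / 2 by
    push_cast; ring, Complex.sin_add_pi_div_two, Complex.cos_mul_I, Complex.ofReal_cosh]

lemma sin_pi_mul_neg_half_add (t : ℝ) :
    Complex.sin (Real.pi * ((-(1 / 2) : ℝ) + t * I)) = -(Real.cosh (Real.pi * t) : ℂ) := by
  rw [show (Real.pi * ((-(1 / 2) : ℝ) + t * I) : ℂ) = (Real.pi * t : ℝ) * I - Real.pi / 2 by
    push_cast; ring, Complex.sin_sub_pi_div_two, Complex.cos_mul_I, Complex.ofReal_cosh]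

variable {F : ℂ → ℂ} {C a : ℝ}

/-- The quotient `(F w - F 0) / sin (π w)`, with its removable singularity removed. -/
noncomputable def sinQuotient (F : ℂ → ℂ) (w : ℂ) : ℂ :=
  dslope F 0 w / dslope (fun w => Complex.sin (Real.pi * w)) 0 w

lemma sinQuotient_of_ne {w : ℂ} (hw : w ≠ 0) :
    sinQuotient F w = (F w - F 0) / Complex.sin (Real.pi * w) := by
  rw [sinQuotient, dslope_of_ne _ hw, dslope_of_ne _ hw, slope_def_field, slope_def_field]
  simp only [sub_zero, mul_zero, Complex.sin_zero]
  rw [div_div_div_cancel_right₀ hw]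

lemma differentiableOn_sinQuotient (hF : Differentiable ℂ F) :
    DifferentiableOn ℂ (sinQuotient F) {w | |w.re| ≤ 1 / 2} := by
  have hd : ∀ G : ℂ → ℂ, Differentiable ℂ G → Differentiable ℂ (dslope G 0) := fun G hG =>
    differentiableOn_univ.1 ((Complex.differentiableOn_dslope univ_mem).2 hG.differentiableOn)
  refine DifferentiableOn.div (hd F hF).differentiableOn (hd _ (by fun_prop)).differentiableOn
    fun w hw => ?_
  rcases eq_or_ne w 0 with rfl | h0
  · rw [dslope_same]
    have : HasDerivAt (fun w : ℂ => Complex.sin (Real.pi * w)) (Complex.cos (Real.pi * 0) * Real.pi) 0 := by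
      simpa using ((hasDerivAt_id (0 : ℂ)).const_mul (Real.pi : ℂ)).csin
    rw [this.deriv]
    simp [Real.pi_ne_zero]
  · rw [dslope_of_ne _ h0, slope_def_field]
    simp only [sub_zero, mul_zero, Complex.sin_zero]
    exact div_ne_zero (sin_pi_mul_ne_zero hw h0) h0

lemma norm_sinQuotient_le (ha : 0 ≤ a) (hb : ∀ w : ℂ, |w.re| ≤ 1 / 2 → ‖F w‖ ≤ C * Real.exp (a * |w.im|))
    {w : ℂ} (hw : |w.re| ≤ 1 / 2) (h1 : 1 ≤ |w.im|) :
    ‖sinQuotient F w‖ ≤ 8 * C * Real.exp (-((Real.pi - a) * |w.im|)) := by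
  have hC : ‖F 0‖ ≤ C := by simpa using hb 0 (by simp)
  have hC0 : 0 ≤ C := (norm_nonneg _).trans hC
  have h0 : w ≠ 0 := by rintro rfl; simp at h1; linarith
  rw [sinQuotient_of_ne h0, norm_div]
  have hs := half_exp_sub_le_norm_sin (Real.pi * w)
  have him : |((Real.pi : ℂ) * w).im| = Real.pi * |w.im| := by
    rw [Complex.im_ofReal_mul, abs_mul, abs_of_pos Real.pi_pos]
  rw [him] at hs
  have he : 2 ≤ Real.exp (Real.pi * |w.im|) := by
    have h3 := Real.pi_gt_three
    have := Real.add_one_le_exp (Real.pi * |w.im|)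
    nlinarith
  have hs' : Real.exp (Real.pi * |w.im|) / 4 ≤ ‖Complex.sin (Real.pi * w)‖ := by linarith
  have hn : ‖F w - F 0‖ ≤ 2 * C * Real.exp (a * |w.im|) := by
    have := norm_sub_le (F w) (F 0)
    have h2 := hb w hw
    have h3 : 1 ≤ Real.exp (a * |w.im|) := Real.one_le_exp (by positivity)
    nlinarith
  calc _ ≤ 2 * C * Real.exp (a * |w.im|) / (Real.exp (Real.pi * |w.im|) / 4) := by gcongr
    _ = 8 * C * (Real.exp (a * |w.im|) * Real.exp (-(Real.pi * |w.im|))) := by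
        rw [Real.exp_neg]; field_simp; ring
    _ = _ := by rw [← Real.exp_add]; ring_nf

/-- The residue theorem for `F w / sin (π w)` on the strip `|re w| ≤ 1 / 2`. -/
theorem integral_sech_contour (hF : Differentiable ℂ F) (ha : 0 ≤ a) (ha' : a < Real.pi)
    (hb : ∀ w : ℂ, |w.re| ≤ 1 / 2 → ‖F w‖ ≤ C * Real.exp (a * |w.im|)) :
    ∫ t : ℝ, sech t • (F ((1 / 2 : ℝ) + t * I) + F ((-(1 / 2) : ℝ) + t * I)) =
      (∫ t : ℝ, sech t • (2 : ℂ)) * F 0 := by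
  have hs := continuous_sech
  have hFc := hF.continuous
  have hC : ‖F 0‖ ≤ C := by simpa using hb 0 (by simp)
  have hint : Integrable fun t : ℝ =>
      sech t • (F ((1 / 2 : ℝ) + t * I) + F ((-(1 / 2) : ℝ) + t * I)) := by
    refine ((integrable_exp_neg_mul_abs (sub_pos.2 ha')).const_mul (4 * C)).mono'
      (by fun_prop) (Eventually.of_forall fun t => ?_)
    have h1 := hb ((1 / 2 : ℝ) + t * I) (by simp [abs_of_pos])
    have h2 := hb ((-(1 / 2) : ℝ) + t * I) (by simp [abs_of_pos])
    have h3 := norm_add_le (F ((1 / 2 : ℝ) + t * I)) (F ((-(1 / 2) : ℝ) + t * I))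
    simp only [Complex.add_im, Complex.ofReal_im, Complex.mul_im, Complex.ofReal_re, Complex.I_im,
      mul_one, Complex.I_re, mul_zero, add_zero, zero_add] at h1 h2
    rw [norm_smul, Real.norm_eq_abs, abs_of_pos (sech_pos t)]
    calc _ ≤ (2 * Real.exp (-(Real.pi * |t|))) * (2 * C * Real.exp (a * |t|)) := by
          gcongr
          · exact sech_le t
          · linarith
      _ = 4 * C * (Real.exp (-(Real.pi * |t|)) * Real.exp (a * |t|)) := by ring
      _ = _ := by rw [← Real.exp_add]; ring_nf
  have hint2 : Integrable fun t : ℝ => sech t • (2 : ℂ) := by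
    simpa using integrable_bdd_mul_exp_mul_sech (θ := 0) (by simpa using Real.pi_pos)
      (continuous_const (y := (2 : ℂ))) (C := 2) (by simp)
  have hlim := intervalIntegral_tendsto_integral (hint.sub (hint2.mul_const (F 0)))
    tendsto_neg_atTop_atBot tendsto_id
  simp only [Pi.sub_apply] at hlim
  rw [integral_sub hint (hint2.mul_const _), integral_mul_const] at hlim
  refine sub_eq_zero.1 (tendsto_nhds_unique hlim ?_)
  have hrect : ∀ T : ℝ, I • ∫ t in (-T)..T, (sech t • (F ((1 / 2 : ℝ) + t * I)
      + F ((-(1 / 2) : ℝ) + t * I)) - sech t • (2 : ℂ) * F 0) =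
      (∫ x in (-(1 / 2) : ℝ)..(1 / 2), sinQuotient F (x + T * I)) -
        ∫ x in (-(1 / 2) : ℝ)..(1 / 2), sinQuotient F (x + (-T : ℝ) * I) := by
    intro T
    have hr := Complex.integral_boundary_rect_eq_zero_of_differentiableOn (sinQuotient F)
      (⟨-(1 / 2), -T⟩ : ℂ) (⟨1 / 2, T⟩ : ℂ) ((differentiableOn_sinQuotient hF).mono fun w hw => by
        have := hw.1
        rw [Set.mem_preimage, Set.uIcc_of_le (by norm_num)] at this
        exact abs_le.2 this)
    have hcont : ∀ s : ℝ, |s| ≤ 1 / 2 → Continuous fun y : ℝ => sinQuotient F (s + y * I) :=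
      fun s hs => (differentiableOn_sinQuotient hF).continuousOn.comp_continuous (by fun_prop)
        fun y => by simpa using hs
    simp only at hr
    rw [add_sub_assoc, ← smul_sub, ← intervalIntegral.integral_sub
      ((hcont _ (by rw [abs_of_pos] <;> norm_num)).intervalIntegrable _ _)
      ((hcont _ (by rw [abs_neg, abs_of_pos] <;> norm_num)).intervalIntegrable _ _),
      add_comm, add_eq_zero_iff_eq_neg, neg_sub] at hr
    rw [← hr]
    congr 2
    ext t
    rw [sinQuotient_of_ne (fun h => by simpa using congrArg Complex.re h),
      sinQuotient_of_ne (fun h => by simpa using congrArg Complex.re h),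
      sin_pi_mul_half_add, sin_pi_mul_neg_half_add, sech]
    have := Complex.ofReal_ne_zero.2 (Real.cosh_pos (Real.pi * t)).ne'
    simp only [Complex.real_smul, Complex.ofReal_inv]
    field_simp
    ring
  have hh : ∀ σ : ℝ, |σ| = 1 → Tendsto
      (fun T : ℝ => ∫ x in (-(1 / 2) : ℝ)..(1 / 2), sinQuotient F (x + (σ * T : ℝ) * I)) atTop (𝓝 0) := by
    intro σ hσ
    refine squeeze_zero_norm' (a := fun T => 8 * C * Real.exp (-((Real.pi - a) * T))) ?_ ?_
    · filter_upwards [eventually_ge_atTop 1] with T hT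
      have hT' : |σ * T| = T := by rw [abs_mul, hσ, one_mul, abs_of_pos (by linarith)]
      refine (intervalIntegral.norm_integral_le_of_norm_le_const (C := 8 * C * Real.exp (-((Real.pi - a) * T)))
        fun x hx => ?_).trans (by norm_num)
      rw [Set.uIoc_of_le (by norm_num)] at hx
      have := norm_sinQuotient_le ha hb (w := x + (σ * T : ℝ) * I)
        (by simpa using abs_le.2 ⟨hx.1.le, hx.2⟩) (by simpa [hT'] using hT)
      simpa [hT'] using this
    · rw [← mul_zero (8 * C)]
      refine (Real.tendsto_exp_neg_atTop_nhds_zero.comp ?_).const_mul _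
      exact tendsto_id.const_mul_atTop (sub_pos.2 ha')
  have h1 := (hh 1 (by simp)).sub (hh (-1) (by simp))
  simp only [one_mul, neg_one_mul, sub_zero] at h1
  simp only [← hrect] at h1
  have h2 := h1.const_smul (-I)
  simp only [smul_smul, neg_mul, Complex.I_mul_I, neg_neg, one_smul, smul_zero] at h2
  exact h2

end Contour

section FunctionalCalculus

variable {H : Type*} [NormedAddCommGroup H] [InnerProductSpace ℂ H] [CompleteSpace H]

/-- `R` is self-adjoint with spectrum contained in `[0, 2]`. -/
structure SpectrumIcc (R : H →L[ℂ] H) : Prop where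
  isSelfAdjoint : IsSelfAdjoint R
  re_mem : ∀ z ∈ spectrum ℂ R, z.re ∈ Set.Icc (0 : ℝ) 2

lemma spectrumIcc_of_inner {R : H →L[ℂ] H} (hR : ∀ x y, inner ℂ (R x) y = inner ℂ x (R y))
    (h0 : ∀ x, 0 ≤ (inner ℂ (R x) x).re) (h2 : ∀ x, 0 ≤ (inner ℂ ((2 : ℂ) • x - R x) x).re) :
    SpectrumIcc R := by
  have hsa : IsSelfAdjoint R := by
    rw [ContinuousLinearMap.isSelfAdjoint_iff_isSymmetric]
    exact hR
  refine ⟨hsa, fun z hz => ?_⟩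
  open scoped ComplexOrder in
  have hp : ∀ {S : H →L[ℂ] H} {z : ℂ}, 0 ≤ S → z ∈ spectrum ℂ S → 0 ≤ z.re := fun hS hz =>
    (RCLike.nonneg_iff.1 (spectrum_nonneg_of_nonneg hS hz)).1
  refine ⟨hp (nonneg_of_inner hR h0) hz, ?_⟩
  have h : 0 ≤ algebraMap ℂ (H →L[ℂ] H) 2 - R := by
    refine nonneg_of_inner (fun x y => ?_) fun x => ?_
    · simp [Algebra.algebraMap_eq_smul_one, hR, mul_comm]
    · simpa [Algebra.algebraMap_eq_smul_one] using h2 x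
  have hz' : 2 - z ∈ spectrum ℂ (algebraMap ℂ (H →L[ℂ] H) 2 - R) := by
    rw [← spectrum.singleton_sub_eq]
    exact ⟨2, rfl, z, hz, rfl⟩
  have := hp h hz'
  simpa using this

/-- The continuous functional calculus, for functions on the real line. -/
noncomputable def fc (R : H →L[ℂ] H) (f : ℝ → ℂ) : H →L[ℂ] H := cfc (fun z : ℂ => f z.re) R

namespace SpectrumIcc

variable {R : H →L[ℂ] H} {f g : ℝ → ℂ}

lemma fc_mul (_hR : SpectrumIcc R) (hf : Continuous f) (hg : Continuous g) :
    fc R (fun r => f r * g r) = fc R f * fc R g :=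
  cfc_mul _ _ R (by fun_prop) (by fun_prop)

lemma fc_fc_apply (hR : SpectrumIcc R) (hf : Continuous f) (hg : Continuous g) (x : H) :
    fc R f (fc R g x) = fc R (fun r => f r * g r) x := by
  rw [hR.fc_mul hf hg]; rfl

lemma fc_comm_apply (hR : SpectrumIcc R) (hf : Continuous f) (hg : Continuous g) (x : H) :
    fc R f (fc R g x) = fc R g (fc R f x) := by
  rw [hR.fc_fc_apply hf hg, hR.fc_fc_apply hg hf]
  simp only [mul_comm]

lemma fc_congr (hR : SpectrumIcc R) (h : ∀ r ∈ Set.Icc (0 : ℝ) 2, f r = g r) : fc R f = fc R g :=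
  cfc_congr fun z hz => h _ (hR.re_mem z hz)

lemma fc_sub (_hR : SpectrumIcc R) (hf : Continuous f) (hg : Continuous g) :
    fc R (fun r => f r - g r) = fc R f - fc R g :=
  cfc_sub (fun z : ℂ => f z.re) (fun z : ℂ => g z.re) R (by fun_prop) (by fun_prop)

lemma norm_fc_le (hR : SpectrumIcc R) {C : ℝ} (hC : 0 ≤ C) (h : ∀ r ∈ Set.Icc (0 : ℝ) 2, ‖f r‖ ≤ C) : ‖fc R f‖ ≤ C :=
  norm_cfc_le hC fun z hz => h _ (hR.re_mem z hz)

lemma fc_id (hR : SpectrumIcc R) : fc R (fun r => (r : ℂ)) = R := by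
  have := hR.isSelfAdjoint.isStarNormal
  conv_rhs => rw [← cfc_id ℂ R]
  exact cfc_congr fun z hz => (hR.isSelfAdjoint.mem_spectrum_eq_re hz).symm

lemma fc_const (hR : SpectrumIcc R) (c : ℂ) : fc R (fun _ => c) = c • 1 := by
  have := hR.isSelfAdjoint.isStarNormal
  rw [fc, cfc_const c R, Algebra.algebraMap_eq_smul_one]

lemma fc_two_sub (hR : SpectrumIcc R) : fc R (fun r => (2 - r : ℂ)) = (2 : ℂ) • 1 - R := by
  rw [hR.fc_sub (by fun_prop) (by fun_prop), hR.fc_const, hR.fc_id]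

lemma inner_fc_left (x y : H) :
    inner ℂ (fc R f x) y = inner ℂ x (fc R (fun r => conj (f r)) y) := by
  have : fc R (fun r => conj (f r)) = star (fc R f) := cfc_star (fun z : ℂ => f z.re) R
  rw [this, ContinuousLinearMap.star_eq_adjoint, ContinuousLinearMap.adjoint_inner_right]

lemma inner_fc_left_of_real {f : ℝ → ℝ} (x y : H) :
    inner ℂ (fc R (fun r => (f r : ℂ)) x) y = inner ℂ x (fc R (fun r => (f r : ℂ)) y) := by
  simp only [inner_fc_left, Complex.conj_ofReal]

lemma fc_exp (hR : SpectrumIcc R) (hf : Continuous f) (w : ℂ) :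
    fc R (fun r => Complex.exp (w * f r)) = NormedSpace.exp (w • fc R f) := by
  have := hR.isSelfAdjoint.isStarNormal
  rw [fc, fc, ← cfc_smul w (fun z : ℂ => f z.re) R, ← CFC.complex_exp_eq_normedSpace_exp,
    ← cfc_comp' Complex.exp _ R]
  simp only [smul_eq_mul]

lemma differentiable_fc_exp (hR : SpectrumIcc R) (hf : Continuous f) :
    Differentiable ℂ fun w : ℂ => fc R (fun r => Complex.exp (w * f r)) := by
  simp only [hR.fc_exp hf]
  exact fun w => (hasDerivAt_exp_smul_const (fc R f) w).differentiableAt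

end SpectrumIcc
end FunctionalCalculus

section ModularGroup

open Filter Topology

/-- The function `x * x ^ (i t)`. -/
noncomputable def mulCpow (t x : ℝ) : ℂ := x * Complex.exp ((t * Real.log x : ℝ) * I)

lemma norm_mulCpow (t x : ℝ) : ‖mulCpow t x‖ = |x| := by
  rw [mulCpow, norm_mul, Complex.norm_exp_ofReal_mul_I, mul_one, Complex.norm_real, Real.norm_eq_abs]

lemma continuous_mulCpow (t : ℝ) : Continuous (mulCpow t) := by
  rw [continuous_iff_continuousAt]
  intro x
  rcases eq_or_ne x 0 with rfl | hx
  · have h0 : mulCpow t 0 = 0 := by simp [mulCpow]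
    rw [ContinuousAt, h0, tendsto_zero_iff_norm_tendsto_zero]
    simp only [norm_mulCpow]
    exact (continuous_abs.tendsto' 0 0 abs_zero)
  · have := Real.continuousAt_log hx
    unfold mulCpow
    fun_prop

/-- The difference of logarithms `log r - log (2 - r)`. -/
noncomputable def logRatio (r : ℝ) : ℝ := Real.log r - Real.log (2 - r)

/-- The function `r (2 - r) (r / (2 - r)) ^ (i t)`. -/
noncomputable def groupFun (t r : ℝ) : ℂ := mulCpow t r * mulCpow (-t) (2 - r)

lemma continuous_groupFun (t : ℝ) : Continuous (groupFun t) :=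
  (continuous_mulCpow t).mul ((continuous_mulCpow (-t)).comp (by fun_prop))

lemma groupFun_eq (t r : ℝ) :
    groupFun t r = (r * (2 - r) : ℝ) * Complex.exp ((t * logRatio r : ℝ) * I) := by
  have : Complex.exp ((t * logRatio r : ℝ) * I) =
      Complex.exp ((t * Real.log r : ℝ) * I) * Complex.exp ((-t * Real.log (2 - r) : ℝ) * I) := by
    rw [← Complex.exp_add, logRatio]
    push_cast
    ring_nf
  rw [this, groupFun, mulCpow, mulCpow]
  push_cast
  ring

lemma groupFun_zero (r : ℝ) : groupFun 0 r = (r * (2 - r) : ℝ) := by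
  rw [groupFun_eq]; simp

lemma conj_groupFun_mul (t r : ℝ) :
    conj (groupFun t r) * groupFun t r = ((r * (2 - r) : ℝ) : ℂ) * (r * (2 - r) : ℝ) := by
  rw [Complex.conj_mul', groupFun, norm_mul, norm_mulCpow, norm_mulCpow, ← abs_mul]
  norm_cast
  rw [sq_abs, sq]

lemma norm_exp_mul_I_sub_le (x y : ℝ) :
    ‖Complex.exp (x * I) - Complex.exp (y * I)‖ ≤ |x - y| := by
  have : Complex.exp (x * I) - Complex.exp (y * I) =
      Complex.exp (y * I) * (Complex.exp (I * (x - y : ℝ)) - 1) := by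
    rw [mul_sub, ← Complex.exp_add, mul_one]
    push_cast
    ring_nf
  rw [this, norm_mul, Complex.norm_exp_ofReal_mul_I, one_mul]
  exact Real.norm_exp_I_mul_ofReal_sub_one_le

lemma exists_norm_groupFun_sub_le : ∃ C : ℝ, 0 ≤ C ∧ ∀ r ∈ Set.Icc (0 : ℝ) 2, ∀ t s : ℝ,
    ‖groupFun t r - groupFun s r‖ ≤ C * |t - s| := by
  have hc : Continuous fun r : ℝ => r * (2 - r) * logRatio r := by
    have h1 := Real.continuous_mul_log
    have h2 := Real.continuous_mul_log.comp (f := fun r : ℝ => 2 - r) (by fun_prop)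
    have : (fun r : ℝ => r * (2 - r) * logRatio r) =
        fun r => (2 - r) * (r * Real.log r) - r * ((2 - r) * Real.log (2 - r)) := by
      ext r; rw [logRatio]; ring
    rw [this]
    exact (Continuous.mul (by fun_prop) h1).sub (continuous_id.mul h2)
  obtain ⟨C, hC⟩ := isCompact_Icc.exists_bound_of_continuousOn (s := Set.Icc (0 : ℝ) 2) hc.continuousOn
  refine ⟨C, (norm_nonneg _).trans (hC 0 (by simp)), fun r hr t s => ?_⟩
  rw [groupFun_eq, groupFun_eq, ← mul_sub, norm_mul]
  have := norm_exp_mul_I_sub_le (t * logRatio r) (s * logRatio r)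
  rw [← sub_mul, abs_mul] at this
  calc _ ≤ ‖((r * (2 - r) : ℝ) : ℂ)‖ * (|t - s| * |logRatio r|) := by gcongr
    _ = ‖r * (2 - r) * logRatio r‖ * |t - s| := by
      rw [Complex.norm_real, norm_mul _ (logRatio r), Real.norm_eq_abs (logRatio r)]; ring
    _ ≤ _ := by gcongr; exact hC r hr

variable {H : Type*} [NormedAddCommGroup H] [InnerProductSpace ℂ H] [CompleteSpace H]

namespace SpectrumIcc

variable {R : H →L[ℂ] H}

/-- The function `r (2 - r)`. -/
noncomputable def quad (r : ℝ) : ℂ := (r * (2 - r) : ℝ)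

lemma continuous_quad : Continuous quad := by unfold quad; fun_prop

lemma fc_quad_apply (hR : SpectrumIcc R) (x : H) : fc R quad x = R ((2 : ℂ) • x - R x) := by
  have : fc R quad = R * ((2 : ℂ) • 1 - R) := by
    rw [← hR.fc_two_sub]
    conv_rhs => lhs; rw [← hR.fc_id]
    rw [← hR.fc_mul (by fun_prop) (by fun_prop)]
    congr 1
    ext r
    simp [quad]
  rw [this]
  simp

lemma denseRange_fc_quad (hR : SpectrumIcc R) (hinj : ∀ x, R ((2 : ℂ) • x - R x) = 0 → x = 0) :
    DenseRange (fc R quad) :=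
  denseRange_of_symmetric_injective (inner_fc_left_of_real (f := fun r => r * (2 - r)))
    fun x hx => hinj x (by rwa [← hR.fc_quad_apply])

lemma norm_fc_groupFun (hR : SpectrumIcc R) (t : ℝ) (x : H) :
    ‖fc R (groupFun t) x‖ = ‖fc R quad x‖ := by
  have hc := continuous_groupFun t
  have hq := continuous_quad
  rw [← sq_eq_sq₀ (norm_nonneg _) (norm_nonneg _), ← @inner_self_eq_norm_sq ℂ,
    ← @inner_self_eq_norm_sq ℂ, inner_fc_left, inner_fc_left,
    hR.fc_fc_apply (by fun_prop) hc, hR.fc_fc_apply (by fun_prop) hq]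
  congr 3
  refine congrArg (fc R) (funext fun r => ?_)
  rw [conj_groupFun_mul, quad, Complex.conj_ofReal]

/-- The one-parameter unitary group `(R / (2 - R)) ^ (i t)`. -/
noncomputable def unitaryGroup (R : H →L[ℂ] H) (t : ℝ) : H →L[ℂ] H :=
  (fc R (groupFun t)).toLinearMap.extendOfNorm (fc R quad).toLinearMap

lemma unitaryGroup_fc_quad (hR : SpectrumIcc R) (hinj : ∀ x, R ((2 : ℂ) • x - R x) = 0 → x = 0)
    (t : ℝ) (x : H) : unitaryGroup R t (fc R quad x) = fc R (groupFun t) x :=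
  LinearMap.extendOfNorm_eq (hR.denseRange_fc_quad hinj)
    ⟨1, fun x => by simpa using (hR.norm_fc_groupFun t x).le⟩ x

lemma norm_unitaryGroup (hR : SpectrumIcc R) (hinj : ∀ x, R ((2 : ℂ) • x - R x) = 0 → x = 0)
    (t : ℝ) (x : H) : ‖unitaryGroup R t x‖ = ‖x‖ := by
  induction x using (hR.denseRange_fc_quad hinj).induction_on with
  | hp => exact isClosed_eq (by fun_prop) (by fun_prop)
  | ih x => rw [hR.unitaryGroup_fc_quad hinj, hR.norm_fc_groupFun]

lemma unitaryGroup_zero (hR : SpectrumIcc R) (hinj : ∀ x, R ((2 : ℂ) • x - R x) = 0 → x = 0)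
    (x : H) : unitaryGroup R 0 x = x := by
  induction x using (hR.denseRange_fc_quad hinj).induction_on with
  | hp => exact isClosed_eq (by fun_prop) (by fun_prop)
  | ih x =>
    rw [hR.unitaryGroup_fc_quad hinj]
    congr 2
    exact funext groupFun_zero

lemma continuous_unitaryGroup (hR : SpectrumIcc R)
    (hinj : ∀ x, R ((2 : ℂ) • x - R x) = 0 → x = 0) (x : H) :
    Continuous fun t => unitaryGroup R t x := by
  refine continuous_of_uniform_approx_of_continuous fun u hu => ?_
  obtain ⟨ε, hε, hu⟩ := Metric.mem_uniformity_dist.1 hu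
  obtain ⟨y, hy⟩ := (hR.denseRange_fc_quad hinj).exists_dist_lt x hε
  refine ⟨fun t => unitaryGroup R t (fc R quad y), ?_, fun t => hu ?_⟩
  · simp only [hR.unitaryGroup_fc_quad hinj]
    obtain ⟨C, hC0, hC⟩ := exists_norm_groupFun_sub_le
    have : LipschitzWith (Real.toNNReal C) fun t => fc R (groupFun t) := by
      refine LipschitzWith.of_dist_le_mul fun t s => ?_
      rw [dist_eq_norm, Real.coe_toNNReal C hC0, Real.dist_eq,
        ← hR.fc_sub (continuous_groupFun t) (continuous_groupFun s)]
      exact hR.norm_fc_le (by positivity) fun r hr => hC r hr t s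
    exact this.continuous.clm_apply continuous_const
  · rwa [dist_eq_norm, ← map_sub, hR.norm_unitaryGroup hinj, ← dist_eq_norm]

/-- A continuous function agreeing with `logRatio` where `r (2 - r) > ε`. -/
noncomputable def logCut (ε r : ℝ) : ℝ :=
  Real.log (max r (ε / 2)) - Real.log (max (2 - r) (ε / 2))

lemma continuous_logCut {ε : ℝ} (hε : 0 < ε) : Continuous (logCut ε) := by
  have h : ∀ x : ℝ, max x (ε / 2) ≠ 0 := fun x => (lt_max_of_lt_right (by positivity)).ne'
  exact (Continuous.log (by fun_prop) fun r => h r).sub (Continuous.log (by fun_prop) fun r => h _)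

/-- A cutoff vanishing where `r (2 - r) ≤ ε`. -/
noncomputable def cut (ε r : ℝ) : ℝ := max 0 (r * (2 - r) - ε)

lemma continuous_cut (ε : ℝ) : Continuous (cut ε) := by unfold cut; fun_prop

lemma cut_eq_zero_or {ε r : ℝ} (hε : 0 < ε) (hr : r ∈ Set.Icc (0 : ℝ) 2) :
    cut ε r = 0 ∨ (0 < r ∧ 0 < 2 - r ∧ logCut ε r = logRatio r) := by
  rcases le_or_gt (r * (2 - r)) ε with h | h
  · left
    exact max_eq_left (by linarith)
  · right
    obtain ⟨h0, h2⟩ := hr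
    have h1 : ε / 2 ≤ r := by nlinarith
    have h3 : ε / 2 ≤ 2 - r := by nlinarith
    refine ⟨by linarith, by linarith, ?_⟩
    rw [logCut, logRatio, max_eq_left h1, max_eq_left h3]

/-- The powers `(R / (2 - R)) ^ w`, cut off. -/
noncomputable def power (R : H →L[ℂ] H) (ε : ℝ) (w : ℂ) : H →L[ℂ] H :=
  fc R fun r => Complex.exp (w * logCut ε r)

lemma unitaryGroup_cut (hR : SpectrumIcc R) (hinj : ∀ x, R ((2 : ℂ) • x - R x) = 0 → x = 0)
    {ε : ℝ} (hε : 0 < ε) {f : ℝ → ℂ} (hf : Continuous f) (t : ℝ) (x : H) :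
    unitaryGroup R t (fc R (fun r => f r * cut ε r) x) =
      power R ε (t * I) (fc R (fun r => f r * cut ε r) x) := by
  have hl := continuous_logCut hε
  have hcut := continuous_cut ε
  have hg := continuous_groupFun t
  have hq := continuous_quad
  unfold power
  induction x using (hR.denseRange_fc_quad hinj).induction_on with
  | hp => exact isClosed_eq (by fun_prop) (by fun_prop)
  | ih x =>
    rw [hR.fc_comm_apply (by fun_prop) hq, hR.unitaryGroup_fc_quad hinj,
      hR.fc_fc_apply hg (by fun_prop), hR.fc_fc_apply hq (by fun_prop),
      hR.fc_fc_apply (by fun_prop) (by fun_prop)]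
    congr 1
    refine hR.fc_congr fun r hr => ?_
    rcases cut_eq_zero_or hε hr with h | ⟨-, -, h⟩
    · simp [h]
    · rw [groupFun_eq, h, quad]
      push_cast
      ring_nf

end SpectrumIcc
end ModularGroup

section Commutation

open Filter Topology MeasureTheory

variable {H : Type*} [NormedAddCommGroup H] [InnerProductSpace ℂ H] [CompleteSpace H]

namespace SpectrumIcc

variable {R : H →L[ℂ] H}

/-- The function `√(r (2 - r))`. -/
noncomputable def sqrtQuad (r : ℝ) : ℂ := (√(r * (2 - r)) : ℝ)

lemma continuous_sqrtQuad : Continuous sqrtQuad := by unfold sqrtQuad; fun_prop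

lemma sqrtQuad_mul_self {r : ℝ} (hr : r ∈ Set.Icc (0 : ℝ) 2) :
    sqrtQuad r * sqrtQuad r = quad r := by
  rw [sqrtQuad, quad, ← Complex.ofReal_mul,
    Real.mul_self_sqrt (mul_nonneg hr.1 (sub_nonneg.2 hr.2))]

lemma fc_sqrtQuad_fc_sqrtQuad (hR : SpectrumIcc R) (x : H) :
    fc R sqrtQuad (fc R sqrtQuad x) = R ((2 : ℂ) • x - R x) := by
  rw [hR.fc_fc_apply continuous_sqrtQuad continuous_sqrtQuad, ← hR.fc_quad_apply]
  congr 1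
  exact hR.fc_congr fun r hr => sqrtQuad_mul_self hr

lemma fc_sqrtQuad_nonneg (hR : SpectrumIcc R) : 0 ≤ fc R sqrtQuad := by
  have hc : Continuous fun r : ℝ => ((√√(r * (2 - r)) : ℝ) : ℂ) := by fun_prop
  have h : fc R sqrtQuad = fc R (fun r => ((√√(r * (2 - r)) : ℝ) : ℂ)) *
      fc R (fun r => ((√√(r * (2 - r)) : ℝ) : ℂ)) := by
    rw [← hR.fc_mul hc hc]
    congr 1
    ext r
    rw [← Complex.ofReal_mul, Real.mul_self_sqrt (Real.sqrt_nonneg _), sqrtQuad]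
  rw [h]
  refine nonneg_of_inner (fun x y => ?_) fun x => ?_
  · simp only [mul_apply_eq_comp, inner_fc_left_of_real]
  · simp only [mul_apply_eq_comp]
    rw [inner_fc_left_of_real]
    exact inner_self_nonneg (𝕜 := ℂ)

/-- A cut-off version of `√(R (2 - R)) R (2 - R)`. -/
noncomputable def cutOp (R : H →L[ℂ] H) (ε : ℝ) : H →L[ℂ] H :=
  fc R fun r => sqrtQuad r * cut ε r

lemma exp_logCut_mul_sqrtQuad {ε r : ℝ} (hε : 0 < ε) (hr : r ∈ Set.Icc (0 : ℝ) 2) (w : ℂ) :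
    Complex.exp ((w + 1 / 2) * logCut ε r) * (sqrtQuad r * cut ε r) =
      r * (Complex.exp (w * logCut ε r) * cut ε r) := by
  rcases cut_eq_zero_or hε hr with h | ⟨h0, h2, h⟩
  · simp [h]
  · have key : Real.exp (1 / 2 * logRatio r) * √(r * (2 - r)) = r := by
      have he : Real.exp (1 / 2 * logRatio r) ^ 2 = r / (2 - r) := by
        rw [← Real.exp_nat_mul, show ((2 : ℕ) : ℝ) * (1 / 2 * logRatio r) = logRatio r by push_cast; ring,
          logRatio, Real.exp_sub, Real.exp_log h0, Real.exp_log h2]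
      rw [← sq_eq_sq₀ (by positivity) h0.le, mul_pow, Real.sq_sqrt (by positivity), he]
      field_simp
    have key' : Complex.exp (1 / 2 * logRatio r) * sqrtQuad r = r := by
      have := congrArg (fun x : ℝ => (x : ℂ)) key
      push_cast at this
      exact this
    rw [h, add_mul, Complex.exp_add]
    linear_combination Complex.exp (w * logRatio r) * cut ε r * key'

lemma exp_logCut_mul_sqrtQuad' {ε r : ℝ} (hε : 0 < ε) (hr : r ∈ Set.Icc (0 : ℝ) 2) (w : ℂ) :
    Complex.exp ((w - 1 / 2) * logCut ε r) * (sqrtQuad r * cut ε r) =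
      (2 - r) * (Complex.exp (w * logCut ε r) * cut ε r) := by
  rcases cut_eq_zero_or hε hr with h | ⟨h0, h2, h⟩
  · simp [h]
  · have key : Real.exp (-(1 / 2 * logRatio r)) * √(r * (2 - r)) = 2 - r := by
      have he : Real.exp (-(1 / 2 * logRatio r)) ^ 2 = (2 - r) / r := by
        rw [← Real.exp_nat_mul,
          show ((2 : ℕ) : ℝ) * -(1 / 2 * logRatio r) = -logRatio r by push_cast; ring,
          logRatio, neg_sub, Real.exp_sub, Real.exp_log h0, Real.exp_log h2]
      rw [← sq_eq_sq₀ (by positivity) h2.le, mul_pow, Real.sq_sqrt (by positivity), he]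
      field_simp
    have key' : Complex.exp (-(1 / 2 * logRatio r)) * sqrtQuad r = 2 - r := by
      have := congrArg (fun x : ℝ => (x : ℂ)) key
      push_cast at this
      exact this
    rw [h, sub_mul, sub_eq_add_neg, Complex.exp_add]
    linear_combination Complex.exp (w * logRatio r) * cut ε r * key'

section

variable {ε : ℝ}

lemma unitaryGroup_cutOp (hR : SpectrumIcc R) (hinj : ∀ x, R ((2 : ℂ) • x - R x) = 0 → x = 0)
    (hε : 0 < ε) (t : ℝ) (x : H) :
    unitaryGroup R t (cutOp R ε x) = fc R sqrtQuad (power R ε (t * I) (fc R (fun r => cut ε r) x)) := by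
  have hl := continuous_logCut hε
  have hcut := continuous_cut ε
  have hs := continuous_sqrtQuad
  rw [cutOp, hR.unitaryGroup_cut hinj hε continuous_sqrtQuad, power,
    hR.fc_fc_apply (by fun_prop) (by fun_prop), hR.fc_fc_apply (by fun_prop) (by fun_prop),
    hR.fc_fc_apply (by fun_prop) (by fun_prop)]
  congr 2
  ext r
  ring

lemma apply_power_cut (hR : SpectrumIcc R) (hε : 0 < ε) (w : ℂ) (x : H) :
    R (power R ε w (fc R (fun r => cut ε r) x)) = power R ε (w + 1 / 2) (cutOp R ε x) := by
  have hl := continuous_logCut hε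
  have hcut := continuous_cut ε
  have hs := continuous_sqrtQuad
  rw [← DFunLike.congr_fun hR.fc_id, power, power, cutOp,
    hR.fc_fc_apply (by fun_prop) (by fun_prop), hR.fc_fc_apply (by fun_prop) (by fun_prop),
    hR.fc_fc_apply (by fun_prop) (by fun_prop)]
  congr 1
  exact hR.fc_congr fun r hr =>
    (mul_assoc _ _ _).trans (exp_logCut_mul_sqrtQuad hε hr w).symm

lemma two_sub_apply_power_cut (hR : SpectrumIcc R) (hε : 0 < ε) (w : ℂ) (x : H) :
    (2 : ℂ) • power R ε w (fc R (fun r => cut ε r) x) - R (power R ε w (fc R (fun r => cut ε r) x)) =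
      power R ε (w - 1 / 2) (cutOp R ε x) := by
  have hl := continuous_logCut hε
  have hcut := continuous_cut ε
  have hs := continuous_sqrtQuad
  have h : ∀ y, (2 : ℂ) • y - R y = fc R (fun r => (2 - r : ℂ)) y := fun y => by
    rw [hR.fc_two_sub]; simp
  rw [h, power, power, cutOp,
    hR.fc_fc_apply (by fun_prop) (by fun_prop), hR.fc_fc_apply (by fun_prop) (by fun_prop),
    hR.fc_fc_apply (by fun_prop) (by fun_prop)]
  congr 1
  exact hR.fc_congr fun r hr =>
    (mul_assoc _ _ _).trans (exp_logCut_mul_sqrtQuad' hε hr w).symm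

lemma inner_power_left (w : ℂ) (x y : H) :
    inner ℂ (power R ε w x) y = inner ℂ x (power R ε (conj w) y) := by
  rw [power, inner_fc_left, power]
  simp only [← Complex.exp_conj, map_mul, Complex.conj_ofReal]

lemma exists_norm_power_le (hR : SpectrumIcc R) (hε : 0 < ε) :
    ∃ M : ℝ, 0 ≤ M ∧ ∀ w : ℂ, |w.re| ≤ 1 / 2 → ‖power R ε w‖ ≤ M := by
  obtain ⟨M, hM⟩ := isCompact_Icc.exists_bound_of_continuousOn (s := Set.Icc (0 : ℝ) 2)
    (continuous_logCut hε).continuousOn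
  refine ⟨Real.exp (1 / 2 * M), (Real.exp_pos _).le, fun w hw => hR.norm_fc_le (Real.exp_pos _).le fun r hr => ?_⟩
  rw [Complex.norm_exp, Complex.re_mul_ofReal]
  refine Real.exp_le_exp.2 ((le_abs_self _).trans ?_)
  rw [abs_mul]
  have := hM r hr
  rw [Real.norm_eq_abs] at this
  gcongr

lemma inner_unitaryGroup_cutOp (hR : SpectrumIcc R)
    (hinj : ∀ x, R ((2 : ℂ) • x - R x) = 0 → x = 0) (hε : 0 < ε) {S b : H →L[ℂ] H} {c₁ c₂ : ℂ}
    (hb : ∀ x, fc R sqrtQuad (S (fc R sqrtQuad x)) =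
      c₁ • ((2 : ℂ) • b (R x) - R (b (R x))) + c₂ • R (b ((2 : ℂ) • x - R x))) (t : ℝ) (ξ η : H) :
    inner ℂ (unitaryGroup R t (cutOp R ε ξ)) (S (unitaryGroup R t (cutOp R ε η))) =
      c₁ * inner ℂ (cutOp R ε ξ) (power R ε (-((1 / 2 : ℝ) + t * I))
        (b (power R ε ((1 / 2 : ℝ) + t * I) (cutOp R ε η)))) +
      c₂ * inner ℂ (cutOp R ε ξ) (power R ε (-((-(1 / 2) : ℝ) + t * I))
        (b (power R ε ((-(1 / 2) : ℝ) + t * I) (cutOp R ε η)))) := by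
  have hRs : ∀ x y, inner ℂ x (R y) = inner ℂ (R x) y := fun x y =>
    ((ContinuousLinearMap.isSelfAdjoint_iff_isSymmetric.1 hR.isSelfAdjoint) x y).symm
  have h2 : ∀ x y, inner ℂ x ((2 : ℂ) • y - R y) = inner ℂ ((2 : ℂ) • x - R x) y := fun x y => by
    rw [inner_sub_left, inner_sub_right, hRs, inner_smul_left, inner_smul_right, map_ofNat]
  rw [hR.unitaryGroup_cutOp hinj hε, hR.unitaryGroup_cutOp hinj hε]
  set ξ' := power R ε (t * I) (fc R (fun r => cut ε r) ξ) with hξ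
  set η' := power R ε (t * I) (fc R (fun r => cut ε r) η) with hη
  have hT : ∀ x y, inner ℂ (fc R sqrtQuad x) y = inner ℂ x (fc R sqrtQuad y) :=
    inner_fc_left_of_real
  rw [hT, hb, inner_add_right, inner_smul_right, inner_smul_right, h2, hRs, hξ, hη,
    hR.two_sub_apply_power_cut hε, hR.two_sub_apply_power_cut hε, hR.apply_power_cut hε,
    hR.apply_power_cut hε, inner_power_left, inner_power_left]
  congr 6
  · simp [map_ofNat]; ring
  · push_cast; ring_nf
  · simp [map_ofNat]
  · push_cast; ring_nf

lemma integral_inner_unitaryGroup_cutOp (hR : SpectrumIcc R)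
    (hinj : ∀ x, R ((2 : ℂ) • x - R x) = 0 → x = 0) (hε : 0 < ε) {S b : H →L[ℂ] H} {θ : ℝ}
    (hθ : |θ| < Real.pi)
    (hb : ∀ x, fc R sqrtQuad (S (fc R sqrtQuad x)) =
      Complex.exp ((θ / 2 : ℝ) * I) • ((2 : ℂ) • b (R x) - R (b (R x))) +
        Complex.exp (-((θ / 2 : ℝ) * I)) • R (b ((2 : ℂ) • x - R x))) (ξ η : H) :
    ∫ t : ℝ, (Real.exp (-θ * t) * sech t) •
        inner ℂ (unitaryGroup R t (cutOp R ε ξ)) (S (unitaryGroup R t (cutOp R ε η))) =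
      (∫ t : ℝ, sech t • (2 : ℂ)) * inner ℂ (cutOp R ε ξ) (b (cutOp R ε η)) := by
  obtain ⟨M, hM0, hM⟩ := hR.exists_norm_power_le hε
  set β : ℂ → ℂ := fun w => inner ℂ (cutOp R ε ξ) (power R ε (-w) (b (power R ε w (cutOp R ε η))))
    with hβ
  set F : ℂ → ℂ := fun w => Complex.exp (θ * I * w) * β w with hF
  have hd : Differentiable ℂ F := by
    have h1 : Differentiable ℂ (power R ε) :=
      hR.differentiable_fc_exp (f := fun r => (logCut ε r : ℂ))
        (Complex.continuous_ofReal.comp (continuous_logCut hε))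
    have h2 : Differentiable ℂ fun w => power R ε (-w) := h1.comp differentiable_neg
    have h3 : Differentiable ℂ fun w => power R ε (-w) (b (power R ε w (cutOp R ε η))) := by
      fun_prop
    have h4 : Differentiable ℂ β := (innerSL ℂ (cutOp R ε ξ)).differentiable.comp h3
    fun_prop
  have hbound : ∀ w : ℂ, |w.re| ≤ 1 / 2 →
      ‖F w‖ ≤ (‖cutOp R ε ξ‖ * (M * (‖b‖ * (M * ‖cutOp R ε η‖)))) * Real.exp (|θ| * |w.im|) := by
    intro w hw
    rw [hF, norm_mul, mul_comm]
    gcongr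
    · refine (norm_inner_le_norm _ _).trans ?_
      gcongr
      refine (power R ε (-w)).le_of_opNorm_le (hM _ (by simpa using hw)) _ |>.trans ?_
      gcongr
      refine b.le_opNorm _ |>.trans ?_
      gcongr
      exact (power R ε w).le_of_opNorm_le (hM _ hw) _
    · rw [Complex.norm_exp]
      refine Real.exp_le_exp.2 ?_
      rw [← abs_mul]
      refine le_trans (le_of_eq ?_) (neg_abs_le _ |> neg_le.1 |> fun h => h)
      simp
  have hp0 : power R ε 0 = 1 := by simp [power, hR.fc_const]
  have := integral_sech_contour hd (abs_nonneg θ) hθ hbound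
  rw [show F 0 = inner ℂ (cutOp R ε ξ) (b (cutOp R ε η)) by simp [hF, hβ, hp0]] at this
  rw [← this]
  congr 1
  ext t
  rw [hR.inner_unitaryGroup_cutOp hinj hε hb, mul_comm (Real.exp _), mul_smul]
  congr 1
  rw [Complex.real_smul, mul_add, ← mul_assoc, ← mul_assoc, Complex.ofReal_exp, ← Complex.exp_add,
    ← Complex.exp_add]
  have e1 : ((-θ * t : ℝ) : ℂ) + (θ / 2 : ℝ) * I = θ * I * ((1 / 2 : ℝ) + t * I) := by
    push_cast
    linear_combination (-θ * t : ℂ) * Complex.I_mul_I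
  have e2 : ((-θ * t : ℝ) : ℂ) + -((θ / 2 : ℝ) * I) = θ * I * ((-(1 / 2) : ℝ) + t * I) := by
    push_cast
    linear_combination (-θ * t : ℂ) * Complex.I_mul_I
  rw [e1, e2]

end

end SpectrumIcc
end Commutation

section CommutationTheorem

open Filter Topology MeasureTheory

variable {H : Type*} [NormedAddCommGroup H] [InnerProductSpace ℂ H] [CompleteSpace H]

namespace SpectrumIcc

variable {R : H →L[ℂ] H}

lemma tendsto_cutOp (hR : SpectrumIcc R) (x : H) :
    Tendsto (fun ε => cutOp R ε x) (𝓝[>] 0) (𝓝 (fc R (fun r => sqrtQuad r * quad r) x)) := by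
  have hq := continuous_quad
  have hs := continuous_sqrtQuad
  rw [tendsto_iff_norm_sub_tendsto_zero]
  have hlim : Tendsto (fun ε : ℝ => ε * ‖x‖) (𝓝[>] 0) (𝓝 0) :=
    tendsto_nhdsWithin_of_tendsto_nhds ((by fun_prop : Continuous fun ε : ℝ => ε * ‖x‖).tendsto' 0 0 (by simp))
  refine squeeze_zero' (Eventually.of_forall fun _ => norm_nonneg _) ?_ hlim
  filter_upwards [self_mem_nhdsWithin] with ε (hε : 0 < ε)
  have hcut := continuous_cut ε
  rw [← sub_apply, cutOp, ← hR.fc_sub (by fun_prop) (by fun_prop)]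
  refine ContinuousLinearMap.le_of_opNorm_le _ (hR.norm_fc_le hε.le fun r hr => ?_) x
  have h0 : 0 ≤ r * (2 - r) := mul_nonneg hr.1 (sub_nonneg.2 hr.2)
  have h1 : r * (2 - r) ≤ 1 := by nlinarith [sq_nonneg (r - 1)]
  have hs1 : √(r * (2 - r)) ≤ 1 := Real.sqrt_le_one.2 h1
  have hc : |cut ε r - r * (2 - r)| ≤ ε := by
    rw [cut]
    rcases le_total (r * (2 - r) - ε) 0 with h | h
    · rw [max_eq_left h, abs_le]; constructor <;> linarith
    · rw [max_eq_right h, abs_le]; constructor <;> linarith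
  rw [← mul_sub, norm_mul, quad, ← Complex.ofReal_sub, Complex.norm_real, Real.norm_eq_abs, sqrtQuad,
    Complex.norm_real, Real.norm_of_nonneg (Real.sqrt_nonneg _)]
  calc _ ≤ 1 * ε := by gcongr
    _ = ε := one_mul ε

lemma denseRange_fc_sqrtQuad_mul_quad (hR : SpectrumIcc R)
    (hinj : ∀ x, R ((2 : ℂ) • x - R x) = 0 → x = 0) :
    DenseRange (fc R fun r => sqrtQuad r * quad r) := by
  have hq := continuous_quad
  have hs := continuous_sqrtQuad
  have hreal : (fun r => sqrtQuad r * quad r) = fun r => ((√(r * (2 - r)) * (r * (2 - r)) : ℝ) : ℂ) := by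
    ext r; simp [sqrtQuad, quad]
  refine denseRange_of_symmetric_injective ?_ fun x hx => ?_
  · rw [hreal]
    exact inner_fc_left_of_real
  · have hT : fc R sqrtQuad (fc R (fun r => sqrtQuad r * quad r) x) = fc R quad (fc R quad x) := by
      rw [hR.fc_fc_apply hs (by fun_prop), hR.fc_fc_apply hq hq]
      congr 1
      exact hR.fc_congr fun r hr => by rw [← mul_assoc, sqrtQuad_mul_self hr]
    have hx' : fc R (fun r => sqrtQuad r * quad r) x = 0 := hx
    rw [hx', map_zero, hR.fc_quad_apply, hR.fc_quad_apply] at hT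
    exact hinj _ (hinj _ hT.symm)

lemma norm_inner_unitaryGroup_le (hR : SpectrumIcc R)
    (hinj : ∀ x, R ((2 : ℂ) • x - R x) = 0 → x = 0) (S : H →L[ℂ] H) (t : ℝ) (x y : H) :
    ‖inner ℂ (unitaryGroup R t x) (S (unitaryGroup R t y))‖ ≤ ‖x‖ * (‖S‖ * ‖y‖) := by
  refine (norm_inner_le_norm _ _).trans ?_
  rw [hR.norm_unitaryGroup hinj]
  gcongr
  exact (S.le_opNorm _).trans_eq (by rw [hR.norm_unitaryGroup hinj])

lemma continuous_inner_unitaryGroup (hR : SpectrumIcc R)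
    (hinj : ∀ x, R ((2 : ℂ) • x - R x) = 0 → x = 0) (S : H →L[ℂ] H) (x y : H) :
    Continuous fun t => inner ℂ (unitaryGroup R t x) (S (unitaryGroup R t y)) :=
  (hR.continuous_unitaryGroup hinj x).inner (S.continuous.comp (hR.continuous_unitaryGroup hinj y))

lemma continuous_integral_inner_unitaryGroup (hR : SpectrumIcc R)
    (hinj : ∀ x, R ((2 : ℂ) • x - R x) = 0 → x = 0) (S : H →L[ℂ] H) {θ : ℝ} (hθ : |θ| < Real.pi) :
    Continuous fun p : H × H => ∫ t : ℝ, (Real.exp (θ * t) * sech t) •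
        inner ℂ (unitaryGroup R t p.1) (S (unitaryGroup R t p.2)) := by
  rw [continuous_iff_continuousAt]
  intro p
  refine continuousAt_of_dominated
    (bound := fun t => Real.exp (θ * t) * sech t * ((‖p.1‖ + 1) * (‖S‖ * (‖p.2‖ + 1)))) ?_ ?_ ?_ ?_
  · refine Eventually.of_forall fun q => ?_
    have := hR.continuous_inner_unitaryGroup hinj S q.1 q.2
    have hs := continuous_sech
    exact Continuous.aestronglyMeasurable (by fun_prop)
  · have h1 : ∀ᶠ q : H × H in 𝓝 p, ‖q.1‖ < ‖p.1‖ + 1 :=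
      (continuous_fst.norm).continuousAt.eventually_lt_const (lt_add_one _)
    have h2 : ∀ᶠ q : H × H in 𝓝 p, ‖q.2‖ < ‖p.2‖ + 1 :=
      (continuous_snd.norm).continuousAt.eventually_lt_const (lt_add_one _)
    filter_upwards [h1, h2] with q hq1 hq2
    refine Eventually.of_forall fun t => ?_
    have hp : 0 ≤ Real.exp (θ * t) * sech t := mul_nonneg (Real.exp_pos _).le (sech_pos t).le
    rw [norm_smul, Real.norm_of_nonneg hp]
    gcongr
    refine (hR.norm_inner_unitaryGroup_le hinj S t q.1 q.2).trans ?_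
    gcongr
  · exact (integrable_exp_mul_sech hθ).mul_const _
  · refine Eventually.of_forall fun t => Continuous.continuousAt ?_
    fun_prop

lemma integral_inner_unitaryGroup (hR : SpectrumIcc R)
    (hinj : ∀ x, R ((2 : ℂ) • x - R x) = 0 → x = 0) {S b : H →L[ℂ] H} {θ : ℝ}
    (hθ : |θ| < Real.pi)
    (hb : ∀ x, fc R sqrtQuad (S (fc R sqrtQuad x)) =
      Complex.exp ((θ / 2 : ℝ) * I) • ((2 : ℂ) • b (R x) - R (b (R x))) +
        Complex.exp (-((θ / 2 : ℝ) * I)) • R (b ((2 : ℂ) • x - R x))) (ξ η : H) :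
    ∫ t : ℝ, (Real.exp (-θ * t) * sech t) •
        inner ℂ (unitaryGroup R t ξ) (S (unitaryGroup R t η)) =
      (∫ t : ℝ, sech t • (2 : ℂ)) * inner ℂ ξ (b η) := by
  have hcont := hR.continuous_integral_inner_unitaryGroup hinj S (θ := -θ) (by rwa [abs_neg])
  have hdense := hR.denseRange_fc_sqrtQuad_mul_quad hinj
  have hcont' : Continuous fun p : H × H => (∫ t : ℝ, sech t • (2 : ℂ)) * inner ℂ p.1 (b p.2) := by
    fun_prop
  refine congrFun ((hdense.prodMap hdense).equalizer hcont hcont' (funext fun p => ?_)) (ξ, η)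
  have hlim := (hR.tendsto_cutOp p.1).prodMk_nhds (hR.tendsto_cutOp p.2)
  refine tendsto_nhds_unique ((hcont.tendsto _).comp hlim)
    (((hcont'.tendsto _).comp hlim).congr' ?_)
  filter_upwards [self_mem_nhdsWithin] with ε (hε : 0 < ε)
  exact (hR.integral_inner_unitaryGroup_cutOp hinj hε hθ hb p.1 p.2).symm

/-- If `S` has, for each `θ ∈ (-π, π)`, a representation of the stated form by an operator `b`
commuting with `c`, then `S` commutes with `c`. -/
theorem comm_of_forall_exists (hR : SpectrumIcc R)
    (hinj : ∀ x, R ((2 : ℂ) • x - R x) = 0 → x = 0) {S c : H →L[ℂ] H}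
    (h : ∀ θ : ℝ, |θ| < Real.pi → ∃ b : H →L[ℂ] H, Commute c b ∧
      ∀ x, fc R sqrtQuad (S (fc R sqrtQuad x)) =
        Complex.exp ((θ / 2 : ℝ) * I) • ((2 : ℂ) • b (R x) - R (b (R x))) +
          Complex.exp (-((θ / 2 : ℝ) * I)) • R (b ((2 : ℂ) • x - R x))) :
    Commute c S := by
  suffices hS : ∀ ξ η, inner ℂ ξ (S (c η)) = inner ℂ ξ (c (S η)) by
    ext η
    exact (ext_inner_left ℂ fun ξ => hS ξ η).symm
  intro ξ η
  rw [← ContinuousLinearMap.adjoint_inner_left c]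
  set c' := ContinuousLinearMap.adjoint c with hc'
  set f₁ : ℝ → ℂ := fun t => inner ℂ (unitaryGroup R t ξ) (S (unitaryGroup R t (c η))) with hf₁
  set f₂ : ℝ → ℂ := fun t => inner ℂ (unitaryGroup R t (c' ξ)) (S (unitaryGroup R t η)) with hf₂
  have h1 : Continuous f₁ := hR.continuous_inner_unitaryGroup hinj S ξ (c η)
  have h2 : Continuous f₂ := hR.continuous_inner_unitaryGroup hinj S (c' ξ) η
  have hb1 : ∀ t, ‖f₁ t‖ ≤ ‖ξ‖ * (‖S‖ * ‖c η‖) := fun t =>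
    hR.norm_inner_unitaryGroup_le hinj S t ξ (c η)
  have hb2 : ∀ t, ‖f₂ t‖ ≤ ‖c' ξ‖ * (‖S‖ * ‖η‖) := fun t =>
    hR.norm_inner_unitaryGroup_le hinj S t (c' ξ) η
  have key := eq_zero_of_integral_exp_mul_sech (h1.sub h2)
    (fun t => (norm_sub_le _ _).trans (add_le_add (hb1 t) (hb2 t))) (fun θ hθ => ?_) 0
  · simpa only [hf₁, hf₂, hR.unitaryGroup_zero hinj, sub_eq_zero, Pi.sub_apply] using key
  · obtain ⟨b, hcb, hb⟩ := h (-θ) (by rwa [abs_neg])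
    have hθ' : |-θ| < Real.pi := by rwa [abs_neg]
    have i1 := hR.integral_inner_unitaryGroup hinj hθ' hb ξ (c η)
    have i2 := hR.integral_inner_unitaryGroup hinj hθ' hb (c' ξ) η
    rw [neg_neg] at i1 i2
    simp only [Pi.sub_apply, smul_sub]
    rw [integral_sub (integrable_bdd_mul_exp_mul_sech hθ h1 hb1)
      (integrable_bdd_mul_exp_mul_sech hθ h2 hb2), i1, i2, hc',
      ContinuousLinearMap.adjoint_inner_left, show c (b η) = b (c η) from
        DFunLike.congr_fun hcb.eq η, sub_self]

end SpectrumIcc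
end CommutationTheorem

section Algebra

variable {H : Type*} [NormedAddCommGroup H] [InnerProductSpace ℂ H] [CompleteSpace H]

lemma inner_apply_left (x : H →L[ℂ] H) (v w : H) : inner ℂ (x v) w = inner ℂ v (star x w) :=
  (ContinuousLinearMap.adjoint_inner_right x v w).symm

lemma inner_apply_right (x : H →L[ℂ] H) (v w : H) : inner ℂ v (x w) = inner ℂ (star x v) w := by
  rw [inner_apply_left, star_star]

variable {M : VonNeumannAlgebra H}

lemma smul_mem (c : ℂ) {x : H →L[ℂ] H} (hx : x ∈ M) : c • x ∈ M :=
  M.toStarSubalgebra.smul_mem hx c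

lemma real_smul_mem (c : ℝ) {x : H →L[ℂ] H} (hx : x ∈ M) : c • x ∈ M := by
  rw [← Complex.coe_smul]
  exact smul_mem _ hx

lemma apply_comm {a x : H →L[ℂ] H} (ha : a ∈ M.commutant) (hx : x ∈ M) (v : H) :
    x (a v) = a (x v) :=
  DFunLike.congr_fun (VonNeumannAlgebra.mem_commutant_iff.1 ha x hx) v

lemma mem_of_forall_comm {x : H →L[ℂ] H}
    (h : ∀ a ∈ M.commutant, ∀ v, a (x v) = x (a v)) : x ∈ M := by
  rw [← M.commutant_commutant, VonNeumannAlgebra.mem_commutant_iff]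
  exact fun a ha => ContinuousLinearMap.ext (h a ha)

lemma mem_commutant_of_forall_comm {a : H →L[ℂ] H}
    (h : ∀ x ∈ M, ∀ v, x (a v) = a (x v)) : a ∈ M.commutant := by
  rw [VonNeumannAlgebra.mem_commutant_iff]
  exact fun x hx => ContinuousLinearMap.ext (h x hx)

lemma exists_eq_add_I_smul {x : H →L[ℂ] H} (hx : x ∈ M) :
    ∃ p ∈ M, ∃ q ∈ M, IsSelfAdjoint p ∧ IsSelfAdjoint q ∧ x = p + I • q := by
  refine ⟨(realPart x : H →L[ℂ] H), ?_, (imaginaryPart x : H →L[ℂ] H), ?_, (realPart x).2,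
    (imaginaryPart x).2, (realPart_add_I_smul_imaginaryPart x).symm⟩
  · rw [realPart_apply_coe]
    exact real_smul_mem _ (add_mem hx (star_mem hx))
  · rw [imaginaryPart_apply_coe]
    exact smul_mem _ (real_smul_mem _ (sub_mem hx (star_mem hx)))

lemma cfc_mem {x : H →L[ℂ] H} (hx : x ∈ M) (f : ℝ → ℝ) : cfc f x ∈ M := by
  refine mem_of_forall_comm fun a ha v => ?_
  have hc : Commute a x := ContinuousLinearMap.ext fun v => (apply_comm ha hx v).symm
  exact DFunLike.congr_fun (hc.symm.cfc_real f).symm.eq v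

/-- The orbit of `Ω` under `M`. -/
def orbit (M : VonNeumannAlgebra H) (Ω : H) : Submodule ℂ H where
  carrier := {y | ∃ x ∈ M, x Ω = y}
  add_mem' := by
    rintro _ _ ⟨x, hx, rfl⟩ ⟨y, hy, rfl⟩
    exact ⟨x + y, add_mem hx hy, rfl⟩
  zero_mem' := ⟨0, zero_mem M, rfl⟩
  smul_mem' := by
    rintro c _ ⟨x, hx, rfl⟩
    exact ⟨c • x, smul_mem c hx, rfl⟩

variable {Ω : H}

/-- A separating vector is cyclic for the commutant. -/
lemma dense_orbit_commutant (hsep : ∀ x ∈ M, x Ω = 0 → x = 0) :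
    Dense (orbit M.commutant Ω : Set H) := by
  set U := (orbit M.commutant Ω).topologicalClosure with hU
  have hmem : U.starProjection ∈ M := by
    rw [VonNeumannAlgebra.IsStarProjection.mem_iff isStarProjection_starProjection]
    intro a ha
    rw [Submodule.range_starProjection, Module.End.mem_invtSubmodule]
    refine Submodule.topologicalClosure_minimal _ ?_
      ((Submodule.isClosed_topologicalClosure _).preimage a.continuous)
    rintro _ ⟨b, hb, rfl⟩
    exact Submodule.le_topologicalClosure _ ⟨a * b, mul_mem ha hb, rfl⟩
  have h1 : (1 : H →L[ℂ] H) - U.starProjection = 0 := by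
    refine hsep _ (sub_mem (one_mem M) hmem) ?_
    rw [sub_apply, sub_eq_zero, one_apply_eq_self]
    exact (U.starProjection_eq_self_iff.2 <| Submodule.le_topologicalClosure _
      ⟨1, one_mem _, rfl⟩).symm
  rw [Submodule.dense_iff_topologicalClosure_eq_top, eq_top_iff]
  intro x _
  rw [← hU, ← U.starProjection_eq_self_iff]
  rw [sub_eq_zero] at h1
  rw [← h1]
  rfl

lemma ext_of_dense_orbit (hM : Dense (orbit M Ω : Set H)) {v w : H}
    (h : ∀ x ∈ M, inner ℂ (x Ω) v = inner ℂ (x Ω) w) : v = w := by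
  refine ext_inner_left ℂ fun u => ?_
  refine hM.induction ?_ (isClosed_eq (by fun_prop) (by fun_prop)) u
  rintro _ ⟨x, hx, rfl⟩
  exact h x hx

attribute [local instance] InnerProductSpace.complexToReal

/-- The real subspace of vectors `x Ω` with `x ∈ M` self-adjoint. -/
def saOrbit (M : VonNeumannAlgebra H) (Ω : H) : Submodule ℝ H where
  carrier := {y | ∃ x ∈ M, IsSelfAdjoint x ∧ x Ω = y}
  add_mem' := by
    rintro _ _ ⟨x, hx, hx', rfl⟩ ⟨y, hy, hy', rfl⟩
    exact ⟨x + y, add_mem hx hy, hx'.add hy', rfl⟩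
  zero_mem' := ⟨0, zero_mem M, IsSelfAdjoint.zero _, rfl⟩
  smul_mem' := by
    rintro c _ ⟨x, hx, hx', rfl⟩
    exact ⟨c • x, real_smul_mem c hx, by rw [IsSelfAdjoint, star_smul, star_trivial, hx'.star_eq], rfl⟩

/-- The closure of the real subspace of vectors `x Ω` with `x ∈ M` self-adjoint. -/
noncomputable abbrev saClosure (M : VonNeumannAlgebra H) (Ω : H) : Submodule ℝ H :=
  (saOrbit M Ω).topologicalClosure

lemma apply_mem_saClosure {x : H →L[ℂ] H} (hx : x ∈ M) (hsa : IsSelfAdjoint x) :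
    x Ω ∈ saClosure M Ω :=
  Submodule.le_topologicalClosure _ ⟨x, hx, hsa, rfl⟩

lemma saClosure_induction {p : H → Prop} (hp : IsClosed {v | p v})
    (h : ∀ x ∈ M, IsSelfAdjoint x → p (x Ω)) {v : H} (hv : v ∈ saClosure M Ω) : p v :=
  closure_minimal (s := (saOrbit M Ω : Set H)) (t := {v | p v})
    (by rintro _ ⟨x, hx, hx', rfl⟩; exact h x hx hx') hp hv

lemma conj_inner_commutant {a x : H →L[ℂ] H} (ha : a ∈ M.commutant) (hasa : IsSelfAdjoint a)
    (hx : x ∈ M) (hsa : IsSelfAdjoint x) : (inner ℂ (a Ω) (x Ω)).im = 0 := by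
  rw [← Complex.conj_eq_iff_im, inner_conj_symm, inner_apply_left, hsa.star_eq, inner_apply_left,
    hasa.star_eq, apply_comm ha hx]

lemma im_inner_eq_zero {a : H →L[ℂ] H} (ha : a ∈ M.commutant) (hasa : IsSelfAdjoint a) {v : H}
    (hv : v ∈ saClosure M Ω) : (inner ℂ (a Ω) v).im = 0 :=
  saClosure_induction (p := fun v => (inner ℂ (a Ω) v).im = 0)
    (isClosed_eq (by fun_prop) (by fun_prop))
    (fun _ hx hx' => conj_inner_commutant ha hasa hx hx') hv

lemma ext_of_dense_orbit_of_isSelfAdjoint (hM : Dense (orbit M Ω : Set H)) {v w : H}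
    (h : ∀ x ∈ M, IsSelfAdjoint x → inner ℂ (x Ω) v = inner ℂ (x Ω) w) : v = w := by
  refine ext_of_dense_orbit hM fun a ha => ?_
  obtain ⟨p, hp, q, hq, hp', hq', rfl⟩ := exists_eq_add_I_smul ha
  simp only [add_apply, smul_apply, inner_add_left, inner_smul_left, h p hp hp', h q hq hq']

lemma eq_zero_of_mem_of_I_smul_mem (hM' : Dense (orbit M.commutant Ω : Set H)) {v : H}
    (hv : v ∈ saClosure M Ω) (hv' : I • v ∈ saClosure M Ω) : v = 0 := by
  refine ext_of_dense_orbit_of_isSelfAdjoint hM' fun a ha hasa => ?_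
  rw [inner_zero_right]
  refine Complex.ext ?_ (im_inner_eq_zero ha hasa hv)
  simpa [inner_smul_right] using im_inner_eq_zero ha hasa hv'

lemma eq_zero_of_projSum_eq_zero (hM : Dense (orbit M Ω : Set H)) {v : H}
    (hv : projSum (saClosure M Ω) v = 0) : v = 0 := by
  obtain ⟨h1, h2⟩ := starProjection_eq_zero_of_projSum_eq_zero _ hv
  have h3 : (saClosure M Ω).starProjection (I • v) = 0 := by
    rw [starProjection_I_smul, h2, smul_zero]
  rw [Submodule.starProjection_apply_eq_zero_iff, Submodule.mem_orthogonal] at h1 h3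
  refine ext_of_dense_orbit_of_isSelfAdjoint hM fun x hx hx' => ?_
  have h4 := h1 _ (apply_mem_saClosure hx hx')
  have h5 := h3 _ (apply_mem_saClosure hx hx')
  rw [inner_real_eq_re] at h4 h5
  rw [inner_zero_right]
  refine Complex.ext h4 ?_
  simpa [inner_smul_right] using h5

lemma projSum_two_sub_injective (hM : Dense (orbit M Ω : Set H))
    (hM' : Dense (orbit M.commutant Ω : Set H)) {v : H}
    (hv : projSum (saClosure M Ω) ((2 : ℂ) • v - projSum (saClosure M Ω) v) = 0) : v = 0 := by
  obtain ⟨h1, h2⟩ := mem_of_projSum_eq_two_smul _ (eq_zero_of_projSum_eq_zero hM hv)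
  exact eq_zero_of_mem_of_I_smul_mem hM' h1 h2

lemma rotProj_commutant_apply {a : H →L[ℂ] H} (ha : a ∈ M.commutant) (hasa : IsSelfAdjoint a) :
    rotProj (saClosure M Ω) (a Ω) = 0 := by
  rw [rotProj_apply, (Submodule.starProjection_apply_eq_zero_iff _).2, smul_zero]
  rw [Submodule.mem_orthogonal']
  intro v hv
  rw [inner_real_eq_re]
  rw [← neg_eq_zero]
  simpa [inner_smul_left] using im_inner_eq_zero ha hasa hv

lemma projDiff_commutant_apply {a : H →L[ℂ] H} (ha : a ∈ M.commutant) (hasa : IsSelfAdjoint a) :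
    projDiff (saClosure M Ω) (a Ω) = (saClosure M Ω).starProjection (a Ω) := by
  rw [projDiff_apply, rotProj_commutant_apply ha hasa, sub_zero]

lemma projDiff_star_apply {x : H →L[ℂ] H} (hx : x ∈ M) :
    projDiff (saClosure M Ω) (star x Ω) =
      (2 : ℂ) • x Ω - projSum (saClosure M Ω) (x Ω) := by
  have h : ∀ p ∈ M, IsSelfAdjoint p → projDiff (saClosure M Ω) (p Ω) =
      (2 : ℂ) • p Ω - projSum (saClosure M Ω) (p Ω) := fun p hp hp' => by
    rw [projDiff_apply, projSum_apply,
      Submodule.starProjection_eq_self_iff.2 (apply_mem_saClosure hp hp'), two_smul]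
    abel
  obtain ⟨p, hp, q, hq, hp', hq', rfl⟩ := exists_eq_add_I_smul hx
  rw [star_add, star_smul, hp'.star_eq, hq'.star_eq]
  simp only [add_apply, smul_apply, map_add, map_smulₛₗ, h p hp hp', h q hq hq', RingHom.id_apply,
    starRingEnd_apply, star_star]
  module

end Algebra

section RadonNikodym

open Filter Topology

variable {H : Type*} [NormedAddCommGroup H] [InnerProductSpace ℂ H] [CompleteSpace H]
variable {M : VonNeumannAlgebra H} {Ω : H}

attribute [local instance] InnerProductSpace.complexToReal

/-- The self-adjoint elements of `M` of norm at most `r`. -/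
def saBall (M : VonNeumannAlgebra H) (r : ℝ) : Set (H →L[ℂ] H) :=
  {h | h ∈ M ∧ IsSelfAdjoint h ∧ ‖h‖ ≤ r}

/-- The linear map `x ↦ x v` on `M`. -/
def evalMap (M : VonNeumannAlgebra H) (v : H) : M.toStarSubalgebra →ₗ[ℂ] H where
  toFun x := (x : H →L[ℂ] H) v
  map_add' _ _ := rfl
  map_smul' _ _ := rfl

/-- The image of a ball of `M` on `Ω` is sequentially closed. -/
lemma exists_mem_saBall_of_tendsto (hM' : Dense (orbit M.commutant Ω : Set H)) {r : ℝ} (hr : 0 ≤ r)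
    {h : ℕ → H →L[ℂ] H} (hh : ∀ n, h n ∈ saBall M r) {ζ : H}
    (hlim : Tendsto (fun n => h n Ω) atTop (𝓝 ζ)) : ∃ g ∈ saBall M r, g Ω = ζ := by
  have hlim' : ∀ a ∈ M.commutant, Tendsto (fun n => h n (a Ω)) atTop (𝓝 (a ζ)) := fun a ha =>
    ((a.continuous.tendsto ζ).comp hlim).congr fun n => (apply_comm ha (hh n).1 Ω).symm
  have hbd : ∀ a : M.commutant.toStarSubalgebra,
      ‖evalMap M.commutant ζ a‖ ≤ r * ‖evalMap M.commutant Ω a‖ := fun a =>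
    le_of_tendsto (hlim' a a.2).norm <| Eventually.of_forall fun n =>
      (h n).le_of_opNorm_le (hh n).2.2 _
  have hd : DenseRange (evalMap M.commutant Ω) := by
    refine hM'.mono ?_
    rintro _ ⟨a, ha, rfl⟩
    exact ⟨⟨a, ha⟩, rfl⟩
  set g := (evalMap M.commutant ζ).extendOfNorm (evalMap M.commutant Ω) with hg
  have hgapp : ∀ a ∈ M.commutant, g (a Ω) = a ζ := fun a ha =>
    LinearMap.extendOfNorm_eq hd ⟨r, hbd⟩ ⟨a, ha⟩
  refine ⟨g, ⟨mem_of_forall_comm fun b hb v => ?_, ?_, LinearMap.opNorm_extendOfNorm_le hd hr hbd⟩,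
    hgapp 1 (one_mem _)⟩
  · refine hM'.induction ?_ (isClosed_eq (by fun_prop) (by fun_prop)) v
    rintro _ ⟨a, ha, rfl⟩
    rw [hgapp a ha]
    exact (hgapp (b * a) (mul_mem hb ha)).symm
  · rw [ContinuousLinearMap.isSelfAdjoint_iff_isSymmetric]
    intro v w
    refine hM'.induction ?_ (isClosed_eq (by fun_prop) (by fun_prop)) v
    rintro _ ⟨a, ha, rfl⟩
    refine hM'.induction ?_ (isClosed_eq (by fun_prop) (by fun_prop)) w
    rintro _ ⟨b, hb, rfl⟩
    change inner ℂ (g (a Ω)) (b Ω) = inner ℂ (a Ω) (g (b Ω))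
    rw [hgapp a ha, hgapp b hb]
    refine tendsto_nhds_unique ((hlim' a ha).inner tendsto_const_nhds)
      ((tendsto_const_nhds.inner (hlim' b hb)).congr fun n => ?_)
    rw [inner_apply_right (h n), (hh n).2.1.star_eq]

lemma convex_saBall (r : ℝ) : Convex ℝ (saBall M r) := by
  rintro x ⟨hx, hx', hxr⟩ y ⟨hy, hy', hyr⟩ s t hs ht hst
  refine ⟨add_mem (real_smul_mem s hx) (real_smul_mem t hy), ?_, ?_⟩
  · rw [IsSelfAdjoint, star_add, star_smul, star_smul, hx'.star_eq, hy'.star_eq, star_trivial,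
      star_trivial]
  · exact mem_closedBall_zero_iff.1 ((convex_closedBall (0 : H →L[ℂ] H) r)
      (mem_closedBall_zero_iff.2 hxr) (mem_closedBall_zero_iff.2 hyr) hs ht hst)

/-- A commutant element is dominated by the absolute value. -/
lemma re_inner_commutant_le {a x : H →L[ℂ] H} (ha : a ∈ M.commutant) (hx : x ∈ M)
    (hsa : IsSelfAdjoint x) :
    (inner ℂ (x Ω) (a Ω)).re ≤ ‖a‖ * (inner ℂ Ω (cfc (fun t : ℝ => |t|) x Ω)).re := by
  set s := cfc (fun t : ℝ => √|t|) x with hs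
  set g := cfc (fun t : ℝ => √(max t 0) - √(max (-t) 0)) x with hg
  have hsM : s ∈ M := cfc_mem hx _
  have hssa : IsSelfAdjoint s := cfc_predicate _ _
  have hgsa : IsSelfAdjoint g := cfc_predicate _ _
  have hss : s * s = cfc (fun t : ℝ => |t|) x := by
    rw [hs, ← cfc_mul _ _ x]
    simp only [Real.mul_self_sqrt (abs_nonneg _)]
  have hgg : g * g = cfc (fun t : ℝ => |t|) x := by
    rw [hg, ← cfc_mul _ _ x]
    congr 1
    ext t
    rcases le_total 0 t with h | h
    · simp [h, Real.mul_self_sqrt h, abs_of_nonneg h]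
    · simp [h, abs_of_nonpos h, Real.mul_self_sqrt (neg_nonneg.2 h)]
  have hsg : s * g = x := by
    rw [hs, hg, ← cfc_mul _ _ x]
    conv_rhs => rw [← cfc_id ℝ x]
    congr 1
    ext t
    rcases le_total 0 t with h | h
    · simp [h, Real.mul_self_sqrt h, abs_of_nonneg h]
    · simp [h, abs_of_nonpos h, Real.mul_self_sqrt (neg_nonneg.2 h)]
  have hnorm : ∀ y : H →L[ℂ] H, IsSelfAdjoint y → y * y = cfc (fun t : ℝ => |t|) x →
      ‖y Ω‖ ^ 2 = (inner ℂ Ω (cfc (fun t : ℝ => |t|) x Ω)).re := fun y hy hyy => by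
    rw [← hyy, mul_apply_eq_comp, inner_apply_right, hy.star_eq]
    exact (@inner_self_eq_norm_sq ℂ _ _ _ _ _).symm
  have hns := hnorm s hssa hss
  have hng := hnorm g hgsa hgg
  have hsg' : ‖g Ω‖ = ‖s Ω‖ := by
    rw [← sq_eq_sq₀ (norm_nonneg _) (norm_nonneg _), hns, hng]
  rw [← hns, ← hsg, mul_apply_eq_comp, inner_apply_left, hssa.star_eq, apply_comm ha hsM]
  refine (Complex.re_le_norm _).trans ((norm_inner_le_norm _ _).trans ?_)
  rw [hsg']
  calc ‖s Ω‖ * ‖a (s Ω)‖ ≤ ‖s Ω‖ * (‖a‖ * ‖s Ω‖) := by gcongr; exact a.le_opNorm _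
    _ = _ := by ring

lemma exists_sign_approx {x : H →L[ℂ] H} (hx : x ∈ M) (hsa : IsSelfAdjoint x) {ε : ℝ} (hε : 0 < ε) :
    ∃ f ∈ saBall M 1, IsSelfAdjoint (x * f) ∧ ‖cfc (fun t : ℝ => |t|) x - x * f‖ ≤ ε := by
  have hpos : ∀ t : ℝ, 0 < |t| + ε := fun t => by positivity
  have hc : Continuous fun t : ℝ => t / (|t| + ε) :=
    continuous_id.div (by fun_prop) fun t => (hpos t).ne'
  have hxf : x * cfc (fun t : ℝ => t / (|t| + ε)) x = cfc (fun t : ℝ => t * (t / (|t| + ε))) x := by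
    rw [cfc_mul _ _ x (by fun_prop) hc.continuousOn]
    conv_lhs => lhs; rw [← cfc_id' ℝ x]
  refine ⟨cfc (fun t : ℝ => t / (|t| + ε)) x, ⟨cfc_mem hx _, cfc_predicate _ _, ?_⟩, ?_, ?_⟩
  · refine norm_cfc_le zero_le_one fun t _ => ?_
    rw [Real.norm_eq_abs, abs_div, abs_of_pos (hpos t), div_le_one (hpos t)]
    linarith
  · rw [hxf]
    exact cfc_predicate _ _
  · rw [hxf, ← cfc_sub _ _ x (by fun_prop) (by fun_prop)]
    refine norm_cfc_le hε.le fun t _ => ?_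
    have : |t| - t * (t / (|t| + ε)) = |t| / (|t| + ε) * ε := by
      have := (hpos t).ne'
      field_simp
      rw [← sq_abs t]
      ring
    rw [this, norm_mul, Real.norm_of_nonneg hε.le, Real.norm_of_nonneg (by positivity)]
    have : |t| / (|t| + ε) ≤ 1 := (div_le_one (hpos t)).2 (by linarith)
    nlinarith

lemma im_inner_eq_zero_of_isSelfAdjoint {y : H →L[ℂ] H} (hy : IsSelfAdjoint y) (v : H) :
    (inner ℂ v (y v)).im = 0 := by
  rw [← Complex.conj_eq_iff_im, inner_conj_symm, inner_apply_left, hy.star_eq]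

lemma exists_mem_saBall_apply {a x : H →L[ℂ] H} (ha : a ∈ M.commutant) (hx : x ∈ M)
    (hsa : IsSelfAdjoint x) {μ : ℂ} (hμ : 0 < μ.re) {η : ℝ} (hη : 0 < η) :
    ∃ h ∈ saBall M (‖a‖ / μ.re),
      (inner ℂ (x Ω) (a Ω)).re ≤ (inner ℂ (x Ω) (μ • h Ω)).re + η := by
  set ε := η / (‖a‖ * ‖Ω‖ ^ 2 + 1) with hε
  have hε0 : 0 < ε := by positivity
  obtain ⟨f, ⟨hfM, hfsa, hf1⟩, hxf, hfε⟩ := exists_sign_approx hx hsa hε0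
  have hr : 0 ≤ ‖a‖ / μ.re := by positivity
  refine ⟨(‖a‖ / μ.re) • f, ⟨real_smul_mem _ hfM, ?_, ?_⟩, ?_⟩
  · rw [IsSelfAdjoint, star_smul, star_trivial, hfsa.star_eq]
  · rw [norm_smul, Real.norm_of_nonneg hr]
    nlinarith
  have h1 : (inner ℂ (x Ω) (μ • ((‖a‖ / μ.re) • f) Ω)).re = ‖a‖ * (inner ℂ Ω ((x * f) Ω)).re := by
    have h2 := im_inner_eq_zero_of_isSelfAdjoint hxf Ω
    rw [smul_apply, ← Complex.coe_smul, inner_smul_right, inner_smul_right, inner_apply_left,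
      hsa.star_eq, ← mul_apply_eq_comp, Complex.mul_re, Complex.re_ofReal_mul, Complex.im_ofReal_mul,
      h2]
    field_simp
    ring
  have h3 : (inner ℂ Ω (cfc (fun t : ℝ => |t|) x Ω)).re ≤
      (inner ℂ Ω ((x * f) Ω)).re + ε * ‖Ω‖ ^ 2 := by
    have : (inner ℂ Ω ((cfc (fun t : ℝ => |t|) x - x * f) Ω)).re ≤ ‖Ω‖ * (ε * ‖Ω‖) := by
      refine (Complex.re_le_norm _).trans ((norm_inner_le_norm _ _).trans ?_)
      gcongr
      exact ContinuousLinearMap.le_of_opNorm_le _ hfε _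
    rw [sub_apply, inner_sub_right, Complex.sub_re] at this
    nlinarith
  have h4 : ‖a‖ * (ε * ‖Ω‖ ^ 2) ≤ η := by
    have : ε * (‖a‖ * ‖Ω‖ ^ 2 + 1) = η := by rw [hε]; field_simp
    nlinarith
  rw [h1]
  refine (re_inner_commutant_le ha hx hsa).trans ?_
  have := mul_le_mul_of_nonneg_left h3 (norm_nonneg a)
  linarith

lemma exists_mem_saBall_of_mem_saClosure {a : H →L[ℂ] H} (ha : a ∈ M.commutant) {k : H}
    (hk : k ∈ saClosure M Ω) {μ : ℂ} (hμ : 0 < μ.re) {η : ℝ} (hη : 0 < η) :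
    ∃ h ∈ saBall M (‖a‖ / μ.re), (inner ℂ k (a Ω)).re ≤ (inner ℂ k (μ • h Ω)).re + η := by
  set C := ‖a‖ * ‖Ω‖ + ‖μ‖ * (‖a‖ / μ.re * ‖Ω‖) with hC
  have hC0 : 0 ≤ C := by positivity
  set δ := η / 2 / (C + 1) with hδ
  have hδ0 : 0 < δ := by positivity
  obtain ⟨_, ⟨x, hx, hsa, rfl⟩, hxk⟩ := Metric.mem_closure_iff.1
    (show k ∈ closure (saOrbit M Ω : Set H) from hk) δ hδ0
  obtain ⟨h, hh, hle⟩ := exists_mem_saBall_apply (Ω := Ω) ha hx hsa hμ (half_pos hη)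
  refine ⟨h, hh, ?_⟩
  rw [dist_eq_norm] at hxk
  have h1 : (inner ℂ (k - x Ω) (a Ω - μ • h Ω)).re ≤ δ * C := by
    refine (Complex.re_le_norm _).trans ((norm_inner_le_norm _ _).trans ?_)
    gcongr
    refine (norm_sub_le _ _).trans ?_
    rw [norm_smul, hC]
    gcongr
    · exact a.le_opNorm _
    · exact h.le_of_opNorm_le hh.2.2 _
  have h2 : δ * C ≤ η / 2 := by
    have : δ * (C + 1) = η / 2 := by rw [hδ]; field_simp
    nlinarith
  simp only [inner_sub_left, inner_sub_right, Complex.sub_re] at h1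
  linarith

/-- A Radon-Nikodym theorem. -/
theorem exists_starProjection_eq (hM' : Dense (orbit M.commutant Ω : Set H)) {a : H →L[ℂ] H}
    (ha : a ∈ M.commutant) {μ : ℂ} (hμ : 0 < μ.re) :
    ∃ h ∈ M, IsSelfAdjoint h ∧
      (saClosure M Ω).starProjection (a Ω) = (saClosure M Ω).starProjection (μ • h Ω) := by
  set P := (saClosure M Ω).starProjection with hP
  set r := ‖a‖ / μ.re with hr
  have hr0 : 0 ≤ r := by positivity
  set L : (H →L[ℂ] H) →ₗ[ℝ] H :=
    { toFun := fun h => P (μ • h Ω)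
      map_add' := fun x y => by simp
      map_smul' := fun c x => by
        rw [smul_apply, smul_comm, map_smul, RingHom.id_apply] } with hL
  have hLapp : ∀ h, L h = P (μ • h Ω) := fun _ => rfl
  set D : Set H := L '' saBall M r with hD
  have hconv : Convex ℝ D := (convex_saBall r).linear_image L
  have hne : D.Nonempty := ⟨L 0, 0, ⟨zero_mem M, IsSelfAdjoint.zero _, by simpa using hr0⟩, rfl⟩
  have hcoer : ∀ h ∈ M, IsSelfAdjoint h → μ.re * ‖h Ω‖ ≤ ‖L h‖ := fun h hh hsa => by
    rcases eq_or_ne (h Ω) 0 with h0 | h0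
    · simp [h0]
    · have hpos : 0 < ‖h Ω‖ := norm_pos_iff.2 h0
      have h1 : (inner ℂ (h Ω) (L h)).re = μ.re * ‖h Ω‖ ^ 2 := by
        rw [hLapp, ← re_inner_starProjection,
          Submodule.starProjection_eq_self_iff.2 (apply_mem_saClosure hh hsa), inner_smul_right,
          inner_self_eq_norm_sq_to_K]
        rw [← RCLike.ofReal_pow]
        exact Complex.re_mul_ofReal _ _
      have h2 : (inner ℂ (h Ω) (L h)).re ≤ ‖h Ω‖ * ‖L h‖ :=
        (Complex.re_le_norm _).trans (norm_inner_le_norm _ _)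
      rw [h1] at h2
      nlinarith
  have hclosed : IsClosed D := by
    refine IsSeqClosed.isClosed fun u y hu hy => ?_
    choose h hh hhu using hu
    have hcauchy : CauchySeq fun n => h n Ω := by
      rw [Metric.cauchySeq_iff']
      intro ε hε
      obtain ⟨N, hN⟩ := Metric.cauchySeq_iff'.1 hy.cauchySeq (μ.re * ε) (by positivity)
      refine ⟨N, fun n hn => ?_⟩
      have h1 := hN n hn
      rw [dist_eq_norm, ← hhu, ← hhu, ← map_sub] at h1
      have h2 := hcoer (h n - h N) (sub_mem (hh n).1 (hh N).1) ((hh n).2.1.sub (hh N).2.1)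
      rw [dist_eq_norm, ← sub_apply]
      exact lt_of_mul_lt_mul_left (h2.trans_lt h1) hμ.le
    obtain ⟨ζ, hζ⟩ := cauchySeq_tendsto_of_complete hcauchy
    obtain ⟨g, hg, rfl⟩ := exists_mem_saBall_of_tendsto hM' hr0 hh hζ
    refine ⟨g, hg, tendsto_nhds_unique ?_ hy⟩
    rw [hLapp]
    exact ((P.continuous.tendsto _).comp (hζ.const_smul μ)).congr fun n => hhu n
  obtain ⟨p, hpD, hp⟩ := exists_norm_eq_iInf_of_complete_convex hne hclosed.isComplete hconv (P (a Ω))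
  rw [norm_eq_iInf_iff_real_inner_le_zero hconv hpD] at hp
  obtain ⟨h₀, hh₀, rfl⟩ := hpD
  refine ⟨h₀, hh₀.1, hh₀.2.1, ?_⟩
  set k := P (a Ω) - L h₀ with hk
  have hkK : k ∈ saClosure M Ω :=
    sub_mem (Submodule.starProjection_apply_mem _ _) (Submodule.starProjection_apply_mem _ _)
  have hkP : P k = k := Submodule.starProjection_eq_self_iff.2 hkK
  have hkinner : ∀ v, (inner ℂ k (P v)).re = (inner ℂ k v).re := fun v => by
    rw [← re_inner_starProjection, hkP]
  suffices hk0 : ‖k‖ ^ 2 ≤ 0 by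
    have : ‖k‖ = 0 := by nlinarith [norm_nonneg k]
    exact sub_eq_zero.1 (norm_eq_zero.1 this)
  refine le_of_forall_pos_le_add fun η hη => ?_
  obtain ⟨h, hh, hle⟩ := exists_mem_saBall_of_mem_saClosure ha hkK hμ hη
  have h1 := hp (L h) ⟨h, hh, rfl⟩
  rw [inner_real_eq_re, inner_sub_right, Complex.sub_re, hLapp h, hkinner] at h1
  have h2 : (inner ℂ k (L h₀)).re = (inner ℂ k (a Ω)).re - ‖k‖ ^ 2 := by
    have h3 : (inner ℂ k k).re = ‖k‖ ^ 2 := inner_self_eq_norm_sq (𝕜 := ℂ) k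
    have h4 : (inner ℂ k k).re = (inner ℂ k (P (a Ω))).re - (inner ℂ k (L h₀)).re := by
      rw [← Complex.sub_re, ← inner_sub_right, ← hk]
    rw [← hkinner (a Ω)]
    linarith
  linarith

end RadonNikodym

section Commutation

open SpectrumIcc

variable {H : Type*} [NormedAddCommGroup H] [InnerProductSpace ℂ H]

/-- The conjugate `J a J` of a bounded operator by a conjugate-linear operator. -/
noncomputable def conjBy (J : H →L⋆[ℂ] H) (a : H →L[ℂ] H) : H →L[ℂ] H := J.comp (a.comp J)

@[simp]
lemma conjBy_apply (J : H →L⋆[ℂ] H) (a : H →L[ℂ] H) (x : H) : conjBy J a x = J (a (J x)) := rfl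

variable [CompleteSpace H] {M : VonNeumannAlgebra H} {Ω : H}

attribute [local instance] InnerProductSpace.complexToReal

lemma projDiff_injective (hM : Dense (orbit M Ω : Set H))
    (hM' : Dense (orbit M.commutant Ω : Set H)) {v : H}
    (hv : projDiff (saClosure M Ω) v = 0) : v = 0 := by
  refine projSum_two_sub_injective hM hM' ?_
  rw [← projDiff_projDiff, hv, map_zero]

lemma spectrumIcc_projSum (K : Submodule ℝ H) [K.HasOrthogonalProjection] :
    SpectrumIcc (projSum K) := by
  refine spectrumIcc_of_inner (inner_projSum K) (fun x => ?_) fun x => ?_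
  · rw [re_inner_projSum_self]
    positivity
  · rw [re_inner_two_sub_projSum_self]
    positivity

/-- A commutant element is represented on `M` by the form `λ ω(h ·) + conj λ ω(· h)`. -/
lemma exists_inner_commutant_eq (hM' : Dense (orbit M.commutant Ω : Set H)) {a : H →L[ℂ] H}
    (ha : a ∈ M.commutant) (hasa : IsSelfAdjoint a) {l : ℂ} (hl : 0 < l.re) :
    ∃ h ∈ M, IsSelfAdjoint h ∧ ∀ x ∈ M, inner ℂ Ω (a (x Ω)) =
      l * inner ℂ Ω (h (x Ω)) + conj l * inner ℂ Ω (x (h Ω)) := by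
  obtain ⟨h, hh, hsa, hP⟩ := exists_starProjection_eq hM' ha (μ := 2 * conj l) (by simpa using hl)
  have key : ∀ x ∈ M, IsSelfAdjoint x → inner ℂ Ω (a (x Ω)) =
      l * inner ℂ Ω (h (x Ω)) + conj l * inner ℂ Ω (x (h Ω)) := fun x hx hx' => by
    have h1 : (inner ℂ (x Ω) (a Ω)).re = (inner ℂ (x Ω) ((2 * conj l) • h Ω)).re := by
      rw [← Submodule.starProjection_eq_self_iff.2 (apply_mem_saClosure (Ω := Ω) hx hx'),
        re_inner_starProjection, re_inner_starProjection, hP]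
    have h2 : inner ℂ Ω (h (x Ω)) = conj (inner ℂ Ω (x (h Ω))) := by
      rw [inner_conj_symm, inner_apply_left, hx'.star_eq, inner_apply_left, hsa.star_eq]
    have h3 : inner ℂ (x Ω) (a Ω) = inner ℂ Ω (a (x Ω)) := by
      rw [inner_apply_left, hx'.star_eq, apply_comm ha hx]
    have h4 : (inner ℂ Ω (a (x Ω))).im = 0 := by
      rw [inner_apply_right, hasa.star_eq]
      exact conj_inner_commutant ha hasa hx hx'
    have h5 : inner ℂ (x Ω) (h Ω) = inner ℂ Ω (x (h Ω)) := by
      rw [inner_apply_left, hx'.star_eq]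
    rw [h3, inner_smul_right, h5] at h1
    rw [h2]
    generalize inner ℂ Ω (x (h Ω)) = z at h1 ⊢
    refine Complex.ext ?_ ?_
    · rw [h1]
      simp
      ring
    · rw [h4]
      simp
      ring
  refine ⟨h, hh, hsa, fun x hx => ?_⟩
  obtain ⟨p, hp, q, hq, hp', hq', rfl⟩ := exists_eq_add_I_smul hx
  simp only [add_apply, smul_apply, map_add, map_smul, inner_add_right, inner_smul_right,
    key p hp hp', key q hq hq']
  ring

lemma exists_apply_eq_projDiff (hM' : Dense (orbit M.commutant Ω : Set H)) {a : H →L[ℂ] H}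
    (ha : a ∈ M.commutant) : ∃ y ∈ M, y Ω = projDiff (saClosure M Ω) (a Ω) := by
  have key : ∀ p ∈ M.commutant, IsSelfAdjoint p →
      ∃ y ∈ M, y Ω = projDiff (saClosure M Ω) (p Ω) := fun p hp hp' => by
    obtain ⟨h, hh, hsa, hP⟩ := exists_starProjection_eq hM' hp (μ := 1) (by simp)
    rw [one_smul, Submodule.starProjection_eq_self_iff.2 (apply_mem_saClosure hh hsa)] at hP
    exact ⟨h, hh, by rw [projDiff_commutant_apply hp hp', hP]⟩
  obtain ⟨p, hp, q, hq, hp', hq', rfl⟩ := exists_eq_add_I_smul ha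
  obtain ⟨y, hy, hy'⟩ := key p hp hp'
  obtain ⟨z, hz, hz'⟩ := key q hq hq'
  refine ⟨y + conj I • z, add_mem hy (smul_mem _ hz), ?_⟩
  simp only [add_apply, smul_apply, map_add, map_smulₛₗ, hy', hz']

lemma star_apply_eq_projSum (hM : Dense (orbit M Ω : Set H))
    (hM' : Dense (orbit M.commutant Ω : Set H)) {y : H →L[ℂ] H} (hy : y ∈ M) {v : H}
    (h : y Ω = projDiff (saClosure M Ω) v) : star y Ω = projSum (saClosure M Ω) v := by
  rw [← sub_eq_zero]
  refine projDiff_injective hM hM' ?_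
  rw [map_sub, projDiff_star_apply hy, h, two_sub_projSum_projDiff, sub_self]

/-- The operator form of `exists_inner_commutant_eq`. -/
lemma exists_projDiff_commutant_projDiff (hM : Dense (orbit M Ω : Set H))
    (hM' : Dense (orbit M.commutant Ω : Set H)) {a : H →L[ℂ] H}
    (ha : a ∈ M.commutant) (hasa : IsSelfAdjoint a) {l : ℂ} (hl : 0 < l.re) :
    ∃ h ∈ M, ∀ x, projDiff (saClosure M Ω) (a (projDiff (saClosure M Ω) x)) =
      l • ((2 : ℂ) • h (projSum (saClosure M Ω) x) -
        projSum (saClosure M Ω) (h (projSum (saClosure M Ω) x))) +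
      conj l • projSum (saClosure M Ω) (h ((2 : ℂ) • x - projSum (saClosure M Ω) x)) := by
  obtain ⟨h, hh, hsa, hform⟩ := exists_inner_commutant_eq hM' ha hasa hl
  refine ⟨h, hh, ?_⟩
  set R := projSum (saClosure M Ω)
  set N := projDiff (saClosure M Ω)
  have hR : ∀ v w, inner ℂ (R v) w = inner ℂ v (R w) := inner_projSum _
  have hN : ∀ v w, inner ℂ (N v) w = inner ℂ (N w) v := inner_projDiff _
  have hN' : ∀ v w, inner ℂ v (N w) = inner ℂ w (N v) := fun v w => by
    rw [← inner_conj_symm, hN, inner_conj_symm]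
  have hstar : ∀ y ∈ M, ∀ v, y Ω = N v → N (y (h Ω)) = (2 : ℂ) • h (R v) - R (h (R v)) :=
    fun y hy v hv => by
      have := projDiff_star_apply (Ω := Ω) (mul_mem hh (star_mem hy))
      rw [star_mul, star_star, hsa.star_eq] at this
      simp only [mul_apply_eq_comp] at this
      rw [star_apply_eq_projSum hM hM' hy hv] at this
      exact this
  intro v
  refine hM'.induction ?_ (isClosed_eq (by fun_prop) (by fun_prop)) v
  rintro _ ⟨b, hb, rfl⟩
  obtain ⟨y, hy, hyN⟩ := exists_apply_eq_projDiff hM' hb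
  set ξ := b Ω
  refine ext_of_dense_orbit hM' fun c hc => ?_
  obtain ⟨x, hx, hxN⟩ := exists_apply_eq_projDiff hM' hc
  set η := c Ω
  have h1 : inner ℂ η (N (a (N ξ))) = inner ℂ Ω (a ((star y * x) Ω)) := by
    rw [hN', inner_apply_left, hasa.star_eq, ← hyN, ← hxN, mul_apply_eq_comp,
      ← apply_comm ha (star_mem hy), inner_apply_left]
  have h2 : inner ℂ Ω (h ((star y * x) Ω)) = inner ℂ η (N (y (h Ω))) := by
    rw [hN', ← hxN, inner_apply_left, inner_apply_left, hsa.star_eq, mul_apply_eq_comp]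
  have h3 : inner ℂ Ω ((star y * x) (h Ω)) = inner ℂ (N (x (h Ω))) ξ := by
    rw [hN, ← hyN, inner_apply_left, mul_apply_eq_comp]
  rw [h1, hform _ (mul_mem (star_mem hy) hx), h2, h3, hstar y hy ξ hyN, hstar x hx η hxN,
    inner_add_right, inner_smul_right, inner_smul_right]
  congr 2
  simp only [inner_sub_left, inner_sub_right, inner_smul_left, inner_smul_right, hR, map_sub,
    map_smul, inner_apply_left, hsa.star_eq, map_ofNat]

/-- Half of the commutation theorem: `J M' J ⊆ M`. -/
theorem conjBy_mem (hM : Dense (orbit M Ω : Set H))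
    (hM' : Dense (orbit M.commutant Ω : Set H)) {J : H →L⋆[ℂ] H}
    (hJT : ∀ x, J (fc (projSum (saClosure M Ω)) sqrtQuad x) = projDiff (saClosure M Ω) x)
    (hTJ : ∀ x, fc (projSum (saClosure M Ω)) sqrtQuad (J x) = projDiff (saClosure M Ω) x)
    {a : H →L[ℂ] H} (ha : a ∈ M.commutant) : conjBy J a ∈ M := by
  have key : ∀ p ∈ M.commutant, IsSelfAdjoint p → conjBy J p ∈ M := fun p hp hp' => by
    refine mem_of_forall_comm fun c hc v => ?_
    have hcomm : Commute c (conjBy J p) := by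
      refine (spectrumIcc_projSum (saClosure M Ω)).comm_of_forall_exists
        (fun x => projSum_two_sub_injective hM hM') fun θ hθ => ?_
      have hre : 0 < (Complex.exp ((θ / 2 : ℝ) * I)).re := by
        rw [Complex.exp_ofReal_mul_I_re]
        rw [abs_lt] at hθ
        exact Real.cos_pos_of_mem_Ioo ⟨by linarith [hθ.1], by linarith [hθ.2]⟩
      obtain ⟨h, hh, hN⟩ := exists_projDiff_commutant_projDiff hM hM' hp hp' hre
      refine ⟨h, ContinuousLinearMap.ext fun v => (apply_comm hc hh v).symm, fun x => ?_⟩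
      rw [conjBy_apply, hJT, hTJ, hN]
      congr 2
      rw [← Complex.exp_conj, map_mul, Complex.conj_ofReal, Complex.conj_I, mul_neg]
    exact DFunLike.congr_fun hcomm.eq v
  obtain ⟨p, hp, q, hq, hp', hq', rfl⟩ := exists_eq_add_I_smul ha
  have : conjBy J (p + I • q) = conjBy J p + conj I • conjBy J q := by
    ext v
    simp
  rw [this]
  exact add_mem (key p hp hp') (smul_mem _ (key q hq hq'))

end Commutation

section Duality

open SpectrumIcc

variable {H : Type*} [NormedAddCommGroup H] [InnerProductSpace ℂ H]

/-- The diagonal action on pairs. -/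
noncomputable def diag (x : H →L[ℂ] H) : WithLp 2 (H × H) →L[ℂ] WithLp 2 (H × H) :=
  (WithLp.prodContinuousLinearEquiv 2 ℂ H H).symm.toContinuousLinearMap.comp
    ((x.prodMap x).comp (WithLp.prodContinuousLinearEquiv 2 ℂ H H).toContinuousLinearMap)

lemma diag_toLp (x : H →L[ℂ] H) (u v : H) :
    diag x (WithLp.toLp 2 (u, v)) = WithLp.toLp 2 (x u, x v) := rfl

variable [CompleteSpace H] {M : VonNeumannAlgebra H} {Ω : H}

/-- The closure of the orbit of the pair `(v, w)` under the diagonal action of `M`. -/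
noncomputable abbrev orbitPair (M : VonNeumannAlgebra H) (v w : H) :
    Submodule ℂ (WithLp 2 (H × H)) :=
  (LinearMap.range ((WithLp.prodContinuousLinearEquiv 2 ℂ H H).symm.toLinearEquiv.toLinearMap.comp
    ((evalMap M v).prod (evalMap M w)))).topologicalClosure

lemma inner_diag (x : H →L[ℂ] H) (u v : WithLp 2 (H × H)) :
    inner ℂ u (diag x v) = inner ℂ (diag (star x) u) v := by
  rw [WithLp.prod_inner_apply, WithLp.prod_inner_apply]
  exact congrArg₂ _ (inner_apply_right _ _ _) (inner_apply_right _ _ _)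

lemma toLp_mem_orbitPair {x : H →L[ℂ] H} (hx : x ∈ M) (v w : H) :
    WithLp.toLp 2 (x v, x w) ∈ orbitPair M v w :=
  Submodule.le_topologicalClosure _ ⟨⟨x, hx⟩, rfl⟩

lemma diag_mem_orbitPair {x : H →L[ℂ] H} (hx : x ∈ M) {v w : H} {u : WithLp 2 (H × H)}
    (hu : u ∈ orbitPair M v w) : diag x u ∈ orbitPair M v w := by
  refine closure_minimal (t := {u | diag x u ∈ orbitPair M v w}) ?_
    ((Submodule.isClosed_topologicalClosure _).preimage (diag x).continuous) hu
  rintro _ ⟨y, rfl⟩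
  exact toLp_mem_orbitPair (mul_mem hx y.2) v w

lemma starProjection_orbitPair_eq_zero {v w : H} {u : WithLp 2 (H × H)}
    (h : ∀ x ∈ M, inner ℂ (x v) (WithLp.fst u) + inner ℂ (x w) (WithLp.snd u) = 0) :
    (orbitPair M v w).starProjection u = 0 := by
  rw [Submodule.starProjection_apply_eq_zero_iff, orbitPair, Submodule.orthogonal_closure,
    Submodule.mem_orthogonal]
  rintro _ ⟨x, rfl⟩
  exact h x x.2

lemma starProjection_diag {x : H →L[ℂ] H} (hx : x ∈ M) (v w : H) (u : WithLp 2 (H × H)) :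
    (orbitPair M v w).starProjection (diag x u) = diag x ((orbitPair M v w).starProjection u) := by
  refine Submodule.eq_starProjection_of_mem_orthogonal
    (diag_mem_orbitPair hx (Submodule.starProjection_apply_mem _ _)) ?_
  rw [Submodule.mem_orthogonal]
  intro g hg
  rw [← map_sub, inner_diag]
  exact (Submodule.mem_orthogonal _ _).1 (Submodule.sub_starProjection_mem_orthogonal _) _
    (diag_mem_orbitPair (star_mem hx) hg)

attribute [local instance] InnerProductSpace.complexToReal

lemma im_inner_eq_zero_of_rotProj {v : H} (hv : rotProj (saClosure M Ω) v = 0) {x : H →L[ℂ] H}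
    (hx : x ∈ M) (hx' : IsSelfAdjoint x) : (inner ℂ (x Ω) v).im = 0 := by
  have h : rotProj (saClosure M Ω) (I • x Ω) = I • x Ω := by
    rw [rotProj_apply, I_smul_I_smul, neg_neg,
      Submodule.starProjection_eq_self_iff.2 (apply_mem_saClosure hx hx')]
  have h1 : (inner ℂ (I • x Ω) v).re = 0 := by
    rw [← h, re_inner_rotProj, hv, inner_zero_right, Complex.zero_re]
  simpa [inner_smul_left] using h1

lemma inner_apply_eq_of_rotProj {v : H} (hv : rotProj (saClosure M Ω) v = 0) {x : H →L[ℂ] H}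
    (hx : x ∈ M) : inner ℂ v (x Ω) = inner ℂ (star x Ω) v := by
  have key : ∀ p ∈ M, IsSelfAdjoint p → inner ℂ v (p Ω) = inner ℂ (star p Ω) v :=
    fun p hp hp' => by
      rw [hp'.star_eq, ← inner_conj_symm]
      exact Complex.conj_eq_iff_im.2 (im_inner_eq_zero_of_rotProj hv hp hp')
  obtain ⟨p, hp, q, hq, hp', hq', rfl⟩ := exists_eq_add_I_smul hx
  simp only [star_add, star_smul, add_apply, smul_apply, inner_add_left, inner_add_right,
    inner_smul_left, inner_smul_right, key p hp hp', key q hq hq', starRingEnd_apply, star_star]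

lemma eq_zero_of_rotProj_eq_zero (hM : Dense (orbit M Ω : Set H)) {ξ : H}
    (hξ : rotProj (saClosure M Ω) ξ = 0)
    (horth : ∀ a ∈ M.commutant, IsSelfAdjoint a → (inner ℂ ξ (a Ω)).re = 0) : ξ = 0 := by
  set p := (orbitPair M Ω ξ).starProjection with hp
  have hpp : ∀ u v, inner ℂ (p u) v = inner ℂ u (p v) :=
    (orbitPair M Ω ξ).inner_starProjection_left_eq_right
  have hpcomm : ∀ x ∈ M, ∀ u, p (diag x u) = diag x (p u) := fun x hx u =>
    starProjection_diag hx _ _ u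
  have h1 : p (WithLp.toLp 2 (-ξ, Ω)) = 0 := by
    refine starProjection_orbitPair_eq_zero fun x hx => ?_
    change inner ℂ (x Ω) (-ξ) + inner ℂ (x ξ) Ω = 0
    rw [inner_neg_right, inner_apply_left x ξ, inner_apply_eq_of_rotProj hξ (star_mem hx),
      star_star, neg_add_cancel]
  have h2 : p (WithLp.toLp 2 (Ω, ξ)) = WithLp.toLp 2 (Ω, ξ) :=
    Submodule.starProjection_eq_self_iff.2 (toLp_mem_orbitPair (one_mem M) Ω ξ)
  set e := WithLp.prodContinuousLinearEquiv 2 ℂ H H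
  set C : H →L[ℂ] H := (ContinuousLinearMap.snd ℂ H H).comp (e.toContinuousLinearMap.comp
    (p.comp (e.symm.toContinuousLinearMap.comp (ContinuousLinearMap.inl ℂ H H)))) with hC
  have hCapp : ∀ u, C u = (p (WithLp.toLp 2 (u, 0))).snd := fun _ => rfl
  have hCM : C ∈ M.commutant := mem_commutant_of_forall_comm fun x hx v => by
    have := hpcomm x hx (WithLp.toLp 2 (v, 0))
    rw [diag_toLp, map_zero] at this
    rw [hCapp (x v), this]
    rfl
  have hCstar : ∀ u, star C u = (p (WithLp.toLp 2 (0, u))).fst := fun u => by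
    refine ext_inner_left ℂ fun v => ?_
    have := hpp (WithLp.toLp 2 (v, 0)) (WithLp.toLp 2 (0, u))
    rw [WithLp.prod_inner_apply, WithLp.prod_inner_apply] at this
    simp only [inner_zero_right, inner_zero_left, zero_add, add_zero] at this
    rw [← inner_apply_left]
    exact this
  have h3 : p (WithLp.toLp 2 (ξ, 0)) = p (WithLp.toLp 2 (0, Ω)) := by
    have : WithLp.toLp 2 (-ξ, Ω) = WithLp.toLp 2 (0, Ω) - WithLp.toLp 2 (ξ, (0 : H)) := by
      rw [← WithLp.toLp_sub, Prod.mk_sub_mk, zero_sub, sub_zero]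
    rw [this, map_sub, sub_eq_zero] at h1
    exact h1.symm
  have h4 : p (WithLp.toLp 2 (Ω, 0)) = WithLp.toLp 2 (Ω, ξ) - p (WithLp.toLp 2 (0, ξ)) := by
    rw [← h2, ← map_sub, ← WithLp.toLp_sub, Prod.mk_sub_mk, sub_zero, sub_self]
  have h5 := horth (C + star C) (add_mem hCM (star_mem hCM)) (IsSelfAdjoint.add_star_self C)
  rw [add_apply, inner_add_right, Complex.add_re, hCstar, ← h3, hCapp, h4] at h5
  have h6 : inner ℂ ξ (WithLp.toLp 2 (Ω, ξ) - p (WithLp.toLp 2 (0, ξ))).snd =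
      inner ℂ (WithLp.toLp 2 ((0 : H), ξ)) (WithLp.toLp 2 (0, ξ) - p (WithLp.toLp 2 (0, ξ))) := by
    rw [WithLp.prod_inner_apply]
    simp only [inner_zero_left, zero_add]
    rfl
  have h7 : inner ℂ ξ (p (WithLp.toLp 2 (ξ, 0))).fst =
      inner ℂ (WithLp.toLp 2 (ξ, (0 : H))) (p (WithLp.toLp 2 (ξ, 0))) := by
    rw [WithLp.prod_inner_apply]
    simp only [inner_zero_left, add_zero]
    rfl
  have hidem : ∀ u, p (p u) = p u := fun u =>
    Submodule.starProjection_eq_self_iff.2 (Submodule.starProjection_apply_mem _ _)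
  have h8 : ∀ u, (inner ℂ u (p u)).re = ‖p u‖ ^ 2 := fun u => by
    have : inner ℂ (p u) (p u) = inner ℂ u (p u) := by rw [hpp, hidem]
    rw [← this]
    exact inner_self_eq_norm_sq (𝕜 := ℂ) (p u)
  have h9 : ∀ u, (inner ℂ u (u - p u)).re = ‖u - p u‖ ^ 2 := fun u => by
    have : inner ℂ (u - p u) (u - p u) = inner ℂ u (u - p u) := by
      rw [inner_sub_left, hpp, map_sub, hidem, sub_self, inner_zero_right, sub_zero]
    rw [← this]
    exact inner_self_eq_norm_sq (𝕜 := ℂ) (u - p u)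
  rw [h6, h7, h8, h9] at h5
  have h10 : p (WithLp.toLp 2 (ξ, 0)) = 0 := by
    rw [← norm_eq_zero]
    nlinarith [sq_nonneg ‖WithLp.toLp 2 ((0 : H), ξ) - p (WithLp.toLp 2 (0, ξ))‖,
      norm_nonneg (p (WithLp.toLp 2 (ξ, 0)))]
  rw [Submodule.starProjection_apply_eq_zero_iff, Submodule.mem_orthogonal] at h10
  refine ext_of_dense_orbit hM fun x hx => ?_
  have := h10 _ (toLp_mem_orbitPair hx Ω ξ)
  rw [WithLp.prod_inner_apply] at this
  simpa using this

/-- The real projection attached to the commutant. -/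
lemma starProjection_saClosure_commutant (hM : Dense (orbit M Ω : Set H)) (x : H) :
    (saClosure M.commutant Ω).starProjection x = x - rotProj (saClosure M Ω) x := by
  have hQ : ∀ v ∈ saClosure M.commutant Ω, rotProj (saClosure M Ω) v = 0 := fun v hv =>
    saClosure_induction (p := fun v => rotProj (saClosure M Ω) v = 0)
      (isClosed_eq (rotProj (saClosure M Ω)).continuous continuous_const)
      (fun a ha ha' => rotProj_commutant_apply ha ha') hv
  have hmem : ∀ v, rotProj (saClosure M Ω) v = 0 → v ∈ saClosure M.commutant Ω := fun v hv => by
    rw [← Submodule.starProjection_eq_self_iff, eq_comm, ← sub_eq_zero]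
    refine eq_zero_of_rotProj_eq_zero (M := M) hM ?_ fun a ha ha' => ?_
    · rw [map_sub, hv, hQ _ (Submodule.starProjection_apply_mem _ _), sub_zero]
    · rw [re_inner_comm, ← inner_real_eq_re]
      exact (Submodule.mem_orthogonal _ _).1 (Submodule.sub_starProjection_mem_orthogonal v) _
        (apply_mem_saClosure ha ha')
  refine Submodule.eq_starProjection_of_mem_orthogonal
    (hmem _ (by rw [map_sub, rotProj_idem, sub_self])) ?_
  rw [sub_sub_cancel, Submodule.mem_orthogonal]
  intro v hv
  rw [inner_real_eq_re, ← re_inner_rotProj, hQ v hv, inner_zero_left, Complex.zero_re]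

lemma rotProj_saClosure_commutant (hM : Dense (orbit M Ω : Set H)) (x : H) :
    rotProj (saClosure M.commutant Ω) x = x - (saClosure M Ω).starProjection x := by
  rw [rotProj_apply, starProjection_saClosure_commutant hM, rotProj_apply, smul_neg,
    I_smul_I_smul, neg_neg, smul_sub, smul_neg, I_smul_I_smul, I_smul_I_smul, neg_neg, map_neg,
    sub_neg_eq_add, ← sub_eq_add_neg]

lemma projSum_saClosure_commutant (hM : Dense (orbit M Ω : Set H)) (x : H) :
    projSum (saClosure M.commutant Ω) x = (2 : ℂ) • x - projSum (saClosure M Ω) x := by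
  rw [projSum_apply, projSum_apply, starProjection_saClosure_commutant hM,
    rotProj_saClosure_commutant hM, two_smul]
  abel

lemma projDiff_saClosure_commutant (hM : Dense (orbit M Ω : Set H)) (x : H) :
    projDiff (saClosure M.commutant Ω) x = projDiff (saClosure M Ω) x := by
  rw [projDiff_apply, projDiff_apply, starProjection_saClosure_commutant hM,
    rotProj_saClosure_commutant hM]
  abel

lemma fc_projSum_saClosure_commutant (hM : Dense (orbit M Ω : Set H)) :
    fc (projSum (saClosure M.commutant Ω)) sqrtQuad = fc (projSum (saClosure M Ω)) sqrtQuad := by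
  have h1 := spectrumIcc_projSum (saClosure M Ω)
  have h2 := spectrumIcc_projSum (saClosure M.commutant Ω)
  rw [← CFC.sqrt_unique rfl h1.fc_sqrtQuad_nonneg]
  refine (CFC.sqrt_unique (ContinuousLinearMap.ext fun x => ?_) h2.fc_sqrtQuad_nonneg).symm
  rw [mul_apply_eq_comp, mul_apply_eq_comp, h1.fc_sqrtQuad_fc_sqrtQuad,
    h2.fc_sqrtQuad_fc_sqrtQuad]
  simp only [projSum_saClosure_commutant hM, map_sub, map_smul]
  module

/-- Tomita's theorem for a cyclic and separating vector. -/
theorem exists_modularConjugation (hM : Dense (orbit M Ω : Set H))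
    (hM' : Dense (orbit M.commutant Ω : Set H)) :
    ∃ J : H →L⋆[ℂ] H, (∀ x, J (J x) = x) ∧ (∀ x y, inner ℂ (J x) y = inner ℂ (J y) x) ∧
      (∀ a ∈ M, conjBy J a ∈ M.commutant) ∧ ∀ a ∈ M.commutant, conjBy J a ∈ M := by
  have hR := spectrumIcc_projSum (saClosure M Ω)
  obtain ⟨J, hJT, hTJ, hJJ, hJ⟩ := exists_conj_polar (projDiff (saClosure M Ω)) (inner_projDiff _)
    (fun x => projDiff_injective hM hM') hR.fc_sqrtQuad_nonneg fun x => by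
      rw [hR.fc_sqrtQuad_fc_sqrtQuad, projDiff_projDiff]
  refine ⟨J, hJJ, hJ, fun a ha => ?_, fun a ha => conjBy_mem hM hM' hJT hTJ ha⟩
  refine conjBy_mem hM' (by rwa [M.commutant_commutant]) (fun x => ?_) (fun x => ?_)
    (by rwa [M.commutant_commutant])
  · rw [fc_projSum_saClosure_commutant hM, hJT, projDiff_saClosure_commutant hM]
  · rw [fc_projSum_saClosure_commutant hM, hTJ, projDiff_saClosure_commutant hM]

end Duality

section RightAction

variable {H : Type*} [NormedAddCommGroup H] [InnerProductSpace ℂ H]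
  {J : H →L⋆[ℂ] H}

lemma conjBy_conjBy (hJJ : ∀ x, J (J x) = x) (a : H →L[ℂ] H) : conjBy J (conjBy J a) = a := by
  ext v
  simp [hJJ]

lemma conjBy_mul (hJJ : ∀ x, J (J x) = x) (a b : H →L[ℂ] H) :
    conjBy J (a * b) = conjBy J a * conjBy J b := by
  ext v
  simp [hJJ]

lemma conjBy_one (hJJ : ∀ x, J (J x) = x) : conjBy J 1 = 1 := by
  ext v
  simp [hJJ]

variable [CompleteSpace H]

/-- The right action `a ↦ J a⋆ J` of `M` determined by a conjugation `J`. -/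
noncomputable def rightAction (M : VonNeumannAlgebra H) (J : H →L⋆[ℂ] H) :
    M.toStarSubalgebra →ₗ[ℂ] (H →L[ℂ] H) where
  toFun a := conjBy J (star (a : H →L[ℂ] H))
  map_add' a b := by
    ext v
    simp
  map_smul' c a := by
    ext v
    simp

@[simp]
lemma rightAction_apply (M : VonNeumannAlgebra H) (J : H →L⋆[ℂ] H) (a : M.toStarSubalgebra) :
    rightAction M J a = conjBy J (star (a : H →L[ℂ] H)) := rfl

lemma star_conjBy (hJ : ∀ x y, inner ℂ (J x) y = inner ℂ (J y) x) (a : H →L[ℂ] H) :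
    star (conjBy J a) = conjBy J (star a) := by
  refine ContinuousLinearMap.ext fun v => ext_inner_left ℂ fun w => ?_
  rw [← inner_apply_left, conjBy_apply, conjBy_apply, hJ, ← inner_conj_symm w, hJ (star a (J v)),
    inner_conj_symm, inner_apply_right]

end RightAction
end TomitaTakesaki

/-- Commutation theorem for a von Neumann algebra in standard form.  Let `M` be
a von Neumann algebra acting on `H`, in standard form: there is a cyclic and
separating vector `Ω` (so that `(H, Ω)` realizes `L²(M)`).  Then the commutant
of the (left) action of `M` equals the right action of `M`: there is an
injective complex-linear, antimultiplicative, unital and `*`-preserving map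
`ρ : M → B(H)` (the right action, anti-isomorphism onto its image) whose range
is exactly the commutant of `M`.  Consequently every bounded operator on `H`
commuting with the left `M`-action is given by the right action of a unique
element of `M`. -/
theorem standard_form_commutant_is_right_action
    {H : Type*} [NormedAddCommGroup H] [InnerProductSpace ℂ H] [CompleteSpace H]
    (M : VonNeumannAlgebra H) (Ω : H)
    (hcyclic : closure {x : H | ∃ a ∈ M, a Ω = x} = Set.univ)
    (hseparating : ∀ a ∈ M, a Ω = 0 → a = 0) :
    ∃ ρ : ↥M.toStarSubalgebra →ₗ[ℂ] (H →L[ℂ] H),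
      Function.Injective ρ ∧
      (∀ a b : ↥M.toStarSubalgebra, ρ (a * b) = ρ b * ρ a) ∧
      ρ 1 = 1 ∧
      (∀ a : ↥M.toStarSubalgebra, ρ (star a) = star (ρ a)) ∧
      (∀ T : H →L[ℂ] H, T ∈ M.commutant ↔ T ∈ Set.range ρ) ∧
      (∀ T ∈ M.commutant, ∃! a : ↥M.toStarSubalgebra, ρ a = T) := by
  open TomitaTakesaki in
  obtain ⟨J, hJJ, hJ, hM, hM'⟩ := exists_modularConjugation (M := M) (Ω := Ω)
    (dense_iff_closure_eq.2 hcyclic) (dense_orbit_commutant hseparating)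
  have hinj : Function.Injective (rightAction M J) := fun a b hab => by
    have := congrArg (conjBy J) hab
    rw [rightAction_apply, rightAction_apply, conjBy_conjBy hJJ, conjBy_conjBy hJJ] at this
    exact Subtype.ext (star_injective this)
  have hsurj : ∀ T ∈ M.commutant, ∃ a, rightAction M J a = T := fun T hT =>
    ⟨⟨star (conjBy J T), star_mem (hM' T hT)⟩, by
      rw [rightAction_apply, star_star, conjBy_conjBy hJJ]⟩
  refine ⟨rightAction M J, hinj, fun a b => ?_, ?_, fun a => ?_, fun T => ⟨hsurj T, ?_⟩,
    fun T hT => ?_⟩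
  · simp [conjBy_mul hJJ]
  · simp [conjBy_one hJJ]
  · simp [star_conjBy hJ]
  · rintro ⟨a, rfl⟩
    exact hM _ (star_mem a.2)
  · obtain ⟨a, rfl⟩ := hsurj T hT
    exact ⟨a, rfl, fun b hb => hinj hb⟩
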